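/- Let m ≥ 1 and τ = (τ1, …, τm) ∈ ℝ_{>0}^m with τ1 + ⋯ + τm > 1. Then dim_H B_m(Ψ_τ) = dim_H A_m(Ψ_τ). -/

import Mathlib

open MeasureTheory Set

noncomputable section

/-- The set of Ψ-approximable vectors in `[0,1]^m`: points `x` such that for infinitely many
positive integers `q` there exists `p ∈ ℤ^m` with `|q * x i - p i| < Ψ q i` for all `i`. -/
def approxSet (m : ℕ) (Ψ : ℕ → Fin m → ℝ) : Set (Fin m → ℝ) :=
  {x | (∀ i, x i ∈ Set.Icc (0:ℝ) 1) ∧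
    {q : ℕ | 0 < q ∧ ∃ p : Fin m → ℤ,
      ∀ i, |(q : ℝ) * x i - (p i : ℝ)| < Ψ q i}.Infinite}

/-- The set of weighted Ψ-badly approximable vectors:
`B_m(Ψ) = A_m(Ψ) \ ⋂_{0<c<1} A_m(cΨ)`. -/
def badSet (m : ℕ) (Ψ : ℕ → Fin m → ℝ) : Set (Fin m → ℝ) :=
  approxSet m Ψ \ ⋂ c ∈ Set.Ioo (0:ℝ) 1, approxSet m (fun q i => c * Ψ q i)

/-- The power-law approximation function `Ψ_τ`, with `ψ_i(q) = q^{-τ_i}`. -/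
def psiTau (m : ℕ) (τ : Fin m → ℝ) : ℕ → Fin m → ℝ :=
  fun q i => (q : ℝ) ^ (-(τ i))

/-- A finite set of integers whose pairwise differences are at most `L` has at most `L + 1`
elements. -/
lemma card_le_of_sub_le (F : Finset ℤ) {L : ℝ} (hL : 0 ≤ L)
    (h : ∀ x ∈ F, ∀ y ∈ F, (x : ℝ) - y ≤ L) : (F.card : ℝ) ≤ L + 1 := by
  rcases F.eq_empty_or_nonempty with rfl | hne
  · simp; linarith
  · have hsub : F ⊆ Finset.Icc (F.min' hne) (F.max' hne) := fun x hx =>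
      Finset.mem_Icc.2 ⟨F.min'_le x hx, F.le_max' x hx⟩
    have h1 := Finset.card_le_card hsub
    rw [Int.card_Icc] at h1
    have h2 := h _ (F.max'_mem hne) _ (F.min'_mem hne)
    have h3 : F.min' hne ≤ F.max' hne := F.min'_le _ (F.max'_mem hne)
    have h4 : (F.card : ℤ) ≤ F.max' hne + 1 - F.min' hne := by omega
    have h5 : (F.card : ℝ) ≤ F.max' hne + 1 - F.min' hne := by exact_mod_cast h4
    linarith

/-- There are at most `2 * X` nonzero integers of absolute value less than `X`. -/
lemma card_le_of_ne_zero_of_abs_lt (F : Finset ℤ) {X : ℝ} (hX : 0 ≤ X)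
    (h : ∀ r ∈ F, r ≠ 0 ∧ |(r : ℝ)| < X) : (F.card : ℝ) ≤ 2 * X := by
  have hsub : F ⊆ (Finset.Icc (-⌊X⌋) ⌊X⌋).erase 0 := by
    intro r hr
    obtain ⟨h0, h1⟩ := h r hr
    rw [abs_lt] at h1
    refine Finset.mem_erase.2 ⟨h0, Finset.mem_Icc.2 ⟨?_, Int.le_floor.2 h1.2.le⟩⟩
    have : -r ≤ ⌊X⌋ := Int.le_floor.2 (by push_cast; linarith)
    omega
  have hfl : 0 ≤ ⌊X⌋ := Int.floor_nonneg.2 hX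
  have h1 := Finset.card_le_card hsub
  rw [Finset.card_erase_of_mem (by simp [hfl]), Int.card_Icc] at h1
  have h4 : (F.card : ℤ) ≤ 2 * ⌊X⌋ := by omega
  have h5 : (F.card : ℝ) ≤ 2 * ⌊X⌋ := by exact_mod_cast h4
  linarith [Int.floor_le X]

/-- For `q` prime, the number of pairs `(p, p')` with `1 ≤ p < q` and `0 < |n p - q p'| < q δ`
is at most `2 q δ`. -/
lemma card_pairs_le {q : ℕ} (hq : q.Prime) (n : ℕ) {δ : ℝ} (hδ : 0 ≤ δ)
    (F : Finset (ℤ × ℤ))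
    (h : ∀ x ∈ F, x.1 ∈ Finset.Ico (1 : ℤ) q ∧ (n : ℤ) * x.1 - q * x.2 ≠ 0 ∧
      |((n : ℝ) * x.1 - q * x.2)| < q * δ) : (F.card : ℝ) ≤ 2 * (q * δ) := by
  have hq0 : (0 : ℝ) < q := by exact_mod_cast hq.pos
  by_cases hdvd : q ∣ n
  · obtain ⟨k, rfl⟩ := hdvd
    set G : Finset ℤ := (Finset.Icc (-⌊δ⌋) ⌊δ⌋).filter (fun r => r ≠ 0 ∧ |(r : ℝ)| < δ) with hG
    have hinj : F.card ≤ (Finset.Ico (1 : ℤ) q ×ˢ G).card := by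
      refine Finset.card_le_card_of_injOn (fun x => (x.1, (k : ℤ) * x.1 - x.2)) ?_ ?_
      · intro x hx
        obtain ⟨h1, h2, h3⟩ := h x hx
        have e : (((q * k : ℕ) : ℝ) * x.1 - q * x.2) = q * ((k : ℝ) * x.1 - x.2) := by
          push_cast; ring
        rw [e, abs_mul, abs_of_pos hq0] at h3
        have h4 := lt_of_mul_lt_mul_left h3 hq0.le
        have h5 : (k : ℤ) * x.1 - x.2 ≠ 0 := by
          intro h0
          apply h2
          push_cast
          linear_combination (q : ℤ) * h0
        have h6 := abs_lt.1 h4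
        refine Finset.mem_coe.2 (Finset.mem_product.2 ⟨h1, Finset.mem_filter.2 ⟨?_, h5, ?_⟩⟩)
        · have ha : (k : ℤ) * x.1 - x.2 ≤ ⌊δ⌋ := Int.le_floor.2 (by push_cast; linarith [h6.2])
          have hb : -((k : ℤ) * x.1 - x.2) ≤ ⌊δ⌋ :=
            Int.le_floor.2 (by push_cast; linarith [h6.1])
          exact Finset.mem_Icc.2 ⟨by simp only; omega, ha⟩
        · push_cast; exact h4
      · intro x _ y _ hxy
        simp only [Prod.mk.injEq] at hxy
        obtain ⟨h1, h2⟩ := hxy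
        rw [h1] at h2
        exact Prod.ext h1 (by omega)
    rw [Finset.card_product, Int.card_Ico] at hinj
    have hGc := card_le_of_ne_zero_of_abs_lt G hδ (fun r hr => (Finset.mem_filter.1 hr).2)
    have h7 : (F.card : ℝ) ≤ ((((q : ℤ) - 1).toNat : ℕ) : ℝ) * G.card := by exact_mod_cast hinj
    have h8 : ((((q : ℤ) - 1).toNat : ℕ) : ℝ) ≤ q := by
      have : ((q : ℤ) - 1).toNat ≤ q := by omega
      exact_mod_cast this
    calc (F.card : ℝ) ≤ _ := h7
      _ ≤ q * (2 * δ) := by gcongr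
      _ = _ := by ring
  · have hcop : IsCoprime (q : ℤ) (n : ℤ) := by
      rw [Nat.isCoprime_iff_coprime]
      exact (Nat.Prime.coprime_iff_not_dvd hq).2 hdvd
    have hinj : Set.InjOn (fun x : ℤ × ℤ => (n : ℤ) * x.1 - q * x.2) F := by
      intro x hx y hy hxy
      simp only at hxy
      have hx1 := Finset.mem_Ico.1 (h x hx).1
      have hy1 := Finset.mem_Ico.1 (h y hy).1
      have hd : (q : ℤ) ∣ n * (x.1 - y.1) := ⟨x.2 - y.2, by linear_combination hxy⟩
      have hd2 := hcop.dvd_of_dvd_mul_left hd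
      have h1 : x.1 - y.1 = 0 :=
        Int.eq_zero_of_abs_lt_dvd hd2 (abs_lt.2 ⟨by omega, by omega⟩)
      have h1' : x.1 = y.1 := by omega
      rw [h1'] at hxy
      have : (q : ℤ) * x.2 = q * y.2 := by linarith
      have hq' : (q : ℤ) ≠ 0 := by exact_mod_cast hq.ne_zero
      exact Prod.ext h1' (mul_left_cancel₀ hq' this)
    rw [← Finset.card_image_of_injOn hinj]
    refine card_le_of_ne_zero_of_abs_lt _ (by positivity) ?_
    intro r hr
    obtain ⟨x, hx, rfl⟩ := Finset.mem_image.1 hr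
    obtain ⟨_, h2, h3⟩ := h x hx
    exact ⟨h2, by push_cast; exact h3⟩

/-- A finite set of integer vectors is bounded in size by the product of the sizes of its
coordinate projections. -/
lemma card_le_prod_of_image {m : ℕ} {α : Type*} [DecidableEq α] (F : Finset (Fin m → α))
    (b : Fin m → ℝ)
    (h : ∀ i, ((F.image (fun p => p i)).card : ℝ) ≤ b i) : (F.card : ℝ) ≤ ∏ i, b i := by
  have hsub : F ⊆ Fintype.piFinset (fun i => F.image (fun p => p i)) := fun p hp =>
    Fintype.mem_piFinset.2 fun i => Finset.mem_image_of_mem _ hp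
  have h1 := Finset.card_le_card hsub
  rw [Fintype.card_piFinset] at h1
  calc (F.card : ℝ) ≤ ((∏ i, (F.image (fun p => p i)).card : ℕ) : ℝ) := by exact_mod_cast h1
    _ = ∏ i, ((F.image (fun p => p i)).card : ℝ) := by push_cast; rfl
    _ ≤ _ := Finset.prod_le_prod (fun _ _ => by positivity) (fun i _ => h i)

/-- A finite set of integer vectors whose `i`-th coordinates differ by at most `L i` has at most
`∏ i, (L i + 1)` elements. -/
lemma card_le_prod_of_sub_le {m : ℕ} (F : Finset (Fin m → ℤ)) {L : Fin m → ℝ}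
    (hL : ∀ i, 0 ≤ L i) (h : ∀ x ∈ F, ∀ y ∈ F, ∀ i, (x i : ℝ) - y i ≤ L i) :
    (F.card : ℝ) ≤ ∏ i, (L i + 1) := by
  refine card_le_prod_of_image F _ fun i => card_le_of_sub_le _ (hL i) ?_
  intro a ha b hb
  obtain ⟨x, hx, rfl⟩ := Finset.mem_image.1 ha
  obtain ⟨y, hy, rfl⟩ := Finset.mem_image.1 hb
  exact h x hx y hy i

/-- The reals `y` such that `n * y` is within `κ * n ^ (-t)` of an integer. -/
def nearInt (κ t : ℝ) (n : ℕ) : Set ℝ := {y | ∃ p : ℤ, |(n : ℝ) * y - p| < κ * (n : ℝ) ^ (-t)}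

/-- The vectors all of whose coordinates `y i` lie in `nearInt κ (τ i) n`. -/
def nearRat {m : ℕ} (κ : ℝ) (τ : Fin m → ℝ) (n : ℕ) : Set (Fin m → ℝ) :=
  Set.univ.pi fun i => nearInt κ (τ i) n

lemma volume_inter_near_le {n : ℕ} (hn : 0 < n) {a b v : ℝ} (p : ℤ) :
    volume (Ico b (b + a) ∩ {y | |(n : ℝ) * y - p| < v}) ≤ ENNReal.ofReal (min a (2 * v / n)) := by
  have hn' : (0 : ℝ) < n := by exact_mod_cast hn
  rcases min_choice a (2 * v / n) with h | h <;> rw [h]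
  · calc _ ≤ volume (Ico b (b + a)) := measure_mono inter_subset_left
      _ = _ := by rw [Real.volume_Ico]; congr 1; ring
  · calc _ ≤ volume (Ioo ((p - v) / n) ((p + v) / n)) := by
          refine measure_mono ?_
          rintro y ⟨_, hy⟩
          have hy' := abs_lt.1 (show |(n : ℝ) * y - p| < v from hy)
          constructor
          · rw [div_lt_iff₀ hn']; linarith [hy'.1]
          · rw [lt_div_iff₀ hn']; linarith [hy'.2]
      _ = _ := by rw [Real.volume_Ioo]; congr 1; field_simp; ring

/-- The total measure of `nearInt κ t n` inside the intervals `[p / q + a, p / q + 2 a)`,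
`1 ≤ p < q`, for `q` prime. -/
lemma sum_volume_nearInt_le {q : ℕ} (hq : q.Prime) {n : ℕ} (hn : 0 < n) {a κ t : ℝ} (ha : 0 < a)
    (hκ : 0 < κ) (hcond : q ≤ n → κ * (n : ℝ) ^ (-t) ≤ n * a) :
    ∑ p ∈ Finset.Ico (1 : ℤ) q, volume (Ico ((p : ℝ) / q + a) ((p : ℝ) / q + 2 * a) ∩ nearInt κ t n)
      ≤ ENNReal.ofReal (10 * κ * (q * a * (n : ℝ) ^ (-t))) := by
  classical
  have hn' : (0 : ℝ) < n := by exact_mod_cast hn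
  have hq' : (0 : ℝ) < q := by exact_mod_cast hq.pos
  set v : ℝ := κ * (n : ℝ) ^ (-t) with hv
  have hv0 : 0 < v := by positivity
  set M : ℤ := ⌈(n : ℝ) * (1 + 2 * a) + v⌉ with hM
  set hit : ℤ × ℤ → Prop := fun x =>
    (Ico ((x.1 : ℝ) / q + a) ((x.1 : ℝ) / q + 2 * a) ∩ {y | |(n : ℝ) * y - x.2| < v}).Nonempty
    with hhit
  set F : Finset (ℤ × ℤ) := (Finset.Ico (1 : ℤ) q ×ˢ Finset.Icc (-M) M).filter hit with hF
  set μ0 : ENNReal := ENNReal.ofReal (min a (2 * v / n)) with hμ0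
  have hcard : (F.card : ℝ) ≤ 2 * (q * (v + 2 * a * n)) := by
    refine card_pairs_le hq n (by positivity) F ?_
    rintro ⟨p, p'⟩ hx
    obtain ⟨hx1, y, hy1, hy2⟩ := Finset.mem_filter.1 hx
    have hp := (Finset.mem_product.1 hx1).1
    have hy2' := abs_lt.1 (show |(n : ℝ) * y - p'| < v from hy2)
    simp only at hp hy1 ⊢
    refine ⟨hp, ?_, ?_⟩
    · intro h0
      rcases lt_or_ge n q with hlt | hge
      · have hd : (q : ℤ) ∣ n * p := ⟨p', by linarith⟩
        have hpq : Prime (q : ℤ) := Nat.prime_iff_prime_int.1 hq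
        have hp' := Finset.mem_Ico.1 hp
        rcases hpq.dvd_or_dvd hd with h1 | h1
        · have := Int.le_of_dvd (by exact_mod_cast hn) h1
          omega
        · have := Int.le_of_dvd (by omega) h1
          omega
      · have h0' : (n : ℝ) * p = q * p' := by
          have : (n : ℤ) * p = q * p' := by linarith
          exact_mod_cast this
        have h1 : (p' : ℝ) = n * (p / q) := by field_simp; linarith
        have h2 : (n : ℝ) * (p / q + a) ≤ n * y := by gcongr; exact hy1.1
        have := hcond hge
        rw [h1] at hy2'
        linarith [hy2'.2]
    · have e : (n : ℝ) * p - q * p' = q * ((n : ℝ) * y - p' - n * (y - p / q)) := by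
        field_simp; ring
      rw [e, abs_mul, abs_of_pos hq']
      refine mul_lt_mul_of_pos_left ?_ hq'
      have h1 : (n : ℝ) * (y - p / q) ≤ n * (2 * a) := by gcongr; linarith [hy1.2]
      have h2 : 0 ≤ (n : ℝ) * (y - p / q) := mul_nonneg hn'.le (by linarith [hy1.1])
      rw [abs_lt]; constructor <;> linarith [hy2'.1, hy2'.2]
  have hone : ∀ p ∈ Finset.Ico (1 : ℤ) q,
      volume (Ico ((p : ℝ) / q + a) ((p : ℝ) / q + 2 * a) ∩ nearInt κ t n) ≤
        ∑ p' ∈ Finset.Icc (-M) M, if hit (p, p') then μ0 else 0 := by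
    intro p hp
    have hp' := Finset.mem_Ico.1 hp
    rw [← Finset.sum_filter]
    calc _ ≤ volume (⋃ p' ∈ (Finset.Icc (-M) M).filter (fun p' => hit (p, p')),
            (Ico ((p : ℝ) / q + a) ((p : ℝ) / q + 2 * a) ∩ {y | |(n : ℝ) * y - p'| < v})) := by
          refine measure_mono ?_
          rintro y ⟨hy1, p', hy2⟩
          have hy2' := abs_lt.1 hy2
          have hpq : (p : ℝ) / q ≤ 1 := by
            rw [div_le_one hq']; exact_mod_cast hp'.2.le
          have hp0 : (0 : ℝ) ≤ p / q := by
            have : (0 : ℝ) ≤ p := by exact_mod_cast (by omega : (0 : ℤ) ≤ p)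
            positivity
          have hyl : (n : ℝ) * y ≤ n * (1 + 2 * a) := by gcongr; linarith [hy1.2]
          have hy0 : 0 ≤ (n : ℝ) * y := mul_nonneg hn'.le (by linarith [hy1.1])
          have hMr := Int.le_ceil ((n : ℝ) * (1 + 2 * a) + v)
          rw [← hM] at hMr
          have hb1 : p' ≤ M := by
            have : (p' : ℝ) ≤ M := by linarith [hy2'.1]
            exact_mod_cast this
          have hb2 : -M ≤ p' := by
            have : -(M : ℝ) ≤ p' := by
              have : 0 ≤ (n : ℝ) * (1 + 2 * a) := by positivity
              linarith [hy2'.2]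
            exact_mod_cast this
          refine Set.mem_biUnion (x := p') ?_ ⟨hy1, hy2⟩
          exact Finset.mem_coe.2 (Finset.mem_filter.2 ⟨Finset.mem_Icc.2 ⟨hb2, hb1⟩, y, hy1, hy2⟩)
      _ ≤ _ := by
          refine (measure_biUnion_finset_le _ _).trans (Finset.sum_le_sum fun p' _ => ?_)
          have := volume_inter_near_le (v := v) hn (b := (p : ℝ) / q + a) (a := a) p'
          rwa [show (p : ℝ) / q + a + a = p / q + 2 * a by ring] at this
  calc _ ≤ ∑ p ∈ Finset.Ico (1 : ℤ) q, ∑ p' ∈ Finset.Icc (-M) M, if hit (p, p') then μ0 else 0 :=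
        Finset.sum_le_sum hone
    _ = ∑ x ∈ F, μ0 := by rw [hF, Finset.sum_filter, Finset.sum_product]
    _ = ENNReal.ofReal (F.card * min a (2 * v / n)) := by
        rw [Finset.sum_const, nsmul_eq_mul, ENNReal.ofReal_mul (by positivity),
          ENNReal.ofReal_natCast]
    _ ≤ _ := by
        refine ENNReal.ofReal_le_ofReal ?_
        have hm0 : 0 ≤ min a (2 * v / n) := by positivity
        calc (F.card : ℝ) * min a (2 * v / n) ≤ 2 * (q * (v + 2 * a * n)) * min a (2 * v / n) := by
              gcongr
          _ = 2 * q * (v * min a (2 * v / n) + 2 * a * n * min a (2 * v / n)) := by ring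
          _ ≤ 2 * q * (v * a + 2 * a * n * (2 * v / n)) := by
              gcongr
              · exact min_le_left _ _
              · exact min_le_right _ _
          _ = 10 * κ * (q * a * (n : ℝ) ^ (-t)) := by
              rw [hv]; field_simp; ring

/-- The box `∏ [p i / q + a i, p i / q + 2 a i)`. -/
def ratBox {m : ℕ} (a : Fin m → ℝ) (q : ℕ) (p : Fin m → ℤ) : Set (Fin m → ℝ) :=
  Set.univ.pi fun i => Ico ((p i : ℝ) / q + a i) ((p i : ℝ) / q + 2 * a i)

lemma sum_volume_nearRat_le {m : ℕ} {q : ℕ} (hq : q.Prime) {n : ℕ} (hn : 0 < n)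
    {a τ : Fin m → ℝ} {κ : ℝ} (ha : ∀ i, 0 < a i) (hκ : 0 < κ)
    (hcond : q ≤ n → ∀ i, κ * (n : ℝ) ^ (-τ i) ≤ n * a i) :
    ∑ p ∈ Fintype.piFinset (fun _ : Fin m => Finset.Ico (1 : ℤ) q),
        volume (ratBox a q p ∩ nearRat κ τ n)
      ≤ ENNReal.ofReal ((10 * κ * q) ^ m * (∏ i, a i) * (n : ℝ) ^ (-∑ i, τ i)) := by
  have hn' : (0 : ℝ) < n := by exact_mod_cast hn
  calc _ = ∑ p ∈ Fintype.piFinset (fun _ : Fin m => Finset.Ico (1 : ℤ) q),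
        ∏ i, volume (Ico ((p i : ℝ) / q + a i) ((p i : ℝ) / q + 2 * a i) ∩ nearInt κ (τ i) n) := by
        refine Finset.sum_congr rfl fun p _ => ?_
        rw [ratBox, nearRat, ← Set.pi_inter_distrib, volume_pi_pi]
    _ = ∏ i, ∑ p ∈ Finset.Ico (1 : ℤ) q,
          volume (Ico ((p : ℝ) / q + a i) ((p : ℝ) / q + 2 * a i) ∩ nearInt κ (τ i) n) := by
        rw [Finset.prod_univ_sum]
    _ ≤ ∏ i, ENNReal.ofReal (10 * κ * (q * a i * (n : ℝ) ^ (-τ i))) :=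
        Finset.prod_le_prod' fun i _ =>
          sum_volume_nearInt_le hq hn (ha i) hκ (fun h => hcond h i)
    _ = ENNReal.ofReal (∏ i, (10 * κ * (q * a i * (n : ℝ) ^ (-τ i)))) := by
        rw [ENNReal.ofReal_prod_of_nonneg]
        intro i _
        have := (ha i).le
        positivity
    _ = _ := by
        congr 1
        rw [← Finset.sum_neg_distrib, Real.rpow_sum_of_pos hn', ← Fin.prod_const, 
          ← Finset.prod_mul_distrib, ← Finset.prod_mul_distrib]
        exact Finset.prod_congr rfl fun i _ => by ring

/-- The union of `nearRat κ τ n` over `n > N`. -/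
def nearTail {m : ℕ} (κ : ℝ) (τ : Fin m → ℝ) (N : ℕ) : Set (Fin m → ℝ) :=
  ⋃ k : ℕ, nearRat κ τ (k + (N + 1))

/-- The tail `∑_{n > N} n ^ (-σ)`. -/
def zetaTail (σ : ℝ) (N : ℕ) : ENNReal :=
  ∑' k : ℕ, ENNReal.ofReal (((k + (N + 1) : ℕ) : ℝ) ^ (-σ))

lemma tendsto_zetaTail {σ : ℝ} (hσ : 1 < σ) :
    Filter.Tendsto (zetaTail σ) Filter.atTop (nhds 0) := by
  have h1 : Summable (fun n : ℕ => (n : ℝ) ^ (-σ)) := Real.summable_nat_rpow.2 (by linarith)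
  have h2 : ∑' n : ℕ, ENNReal.ofReal ((n : ℝ) ^ (-σ)) ≠ ⊤ := h1.tsum_ofReal_ne_top
  have h3 := ENNReal.tendsto_sum_nat_add _ h2
  exact h3.comp (Filter.tendsto_add_atTop_nat 1)

lemma sum_volume_nearTail_le {m : ℕ} {q : ℕ} (hq : q.Prime) (N : ℕ)
    {a τ : Fin m → ℝ} {κ : ℝ} (ha : ∀ i, 0 < a i) (hκ : 0 < κ)
    (hcond : ∀ n : ℕ, q ≤ n → ∀ i, κ * (n : ℝ) ^ (-τ i) ≤ n * a i) :
    ∑ p ∈ Fintype.piFinset (fun _ : Fin m => Finset.Ico (1 : ℤ) q),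
        volume (ratBox a q p ∩ nearTail κ τ N)
      ≤ ENNReal.ofReal ((10 * κ * q) ^ m * (∏ i, a i)) * zetaTail (∑ i, τ i) N := by
  have hpos : 0 ≤ (10 * κ * q) ^ m * (∏ i, a i) :=
    mul_nonneg (by positivity) (Finset.prod_nonneg fun i _ => (ha i).le)
  calc _ ≤ ∑ p ∈ Fintype.piFinset (fun _ : Fin m => Finset.Ico (1 : ℤ) q),
        ∑' k : ℕ, volume (ratBox a q p ∩ nearRat κ τ (k + (N + 1))) := by
        refine Finset.sum_le_sum fun p _ => ?_
        rw [nearTail, inter_iUnion]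
        exact measure_iUnion_le _
    _ = ∑' k : ℕ, ∑ p ∈ Fintype.piFinset (fun _ : Fin m => Finset.Ico (1 : ℤ) q),
          volume (ratBox a q p ∩ nearRat κ τ (k + (N + 1))) :=
        (Summable.tsum_finsetSum fun _ _ => ENNReal.summable).symm
    _ ≤ ∑' k : ℕ, ENNReal.ofReal ((10 * κ * q) ^ m * (∏ i, a i)) *
          ENNReal.ofReal (((k + (N + 1) : ℕ) : ℝ) ^ (-∑ i, τ i)) := by
        refine ENNReal.tsum_le_tsum fun k => ?_
        rw [← ENNReal.ofReal_mul hpos]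
        exact sum_volume_nearRat_le hq (by omega) ha hκ (hcond _)
    _ = _ := ENNReal.tsum_mul_left

/-- The primes in `[2 ^ k, 2 ^ (k + 1))`. -/
def dyadicPrimes (k : ℕ) : Finset ℕ := (Finset.Ico (2 ^ k) (2 ^ (k + 1))).filter Nat.Prime

lemma exists_dyadicPrimes_card_ge (K : ℕ) :
    ∃ k, K ≤ k ∧ (2 : ℝ) ^ k ≤ (k : ℝ) ^ 2 * (dyadicPrimes k).card := by
  by_contra! hcon₀
  obtain ⟨K, hK, hcon⟩ : ∃ K : ℕ, 0 < K ∧ ∀ k, K ≤ k →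
      (k : ℝ) ^ 2 * (dyadicPrimes k).card < (2 : ℝ) ^ k :=
    ⟨K + 1, by omega, fun k hk => hcon₀ k (by omega)⟩
  set f : ℕ → ℝ := Set.indicator {p : ℕ | p.Prime} (fun n : ℕ => 1 / (n : ℝ)) with hf
  have hf0 : ∀ n, 0 ≤ f n := fun n => Set.indicator_nonneg (fun _ _ => by positivity) n
  have hs2 : Summable (fun k : ℕ => 1 / (k : ℝ) ^ 2) :=
    Real.summable_one_div_nat_pow.2 (by norm_num)
  have hblock : ∀ k, K ≤ k → ∑ n ∈ Finset.Ico (2 ^ k) (2 ^ (k + 1)), f n ≤ 1 / (k : ℝ) ^ 2 := by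
    intro k hk
    have h0 := hcon k hk
    have hk0 : (0 : ℝ) < (k : ℝ) ^ 2 := by
      have : 0 < k := by omega
      positivity
    calc _ = ∑ n ∈ dyadicPrimes k, 1 / (n : ℝ) := by
          rw [dyadicPrimes, Finset.sum_filter]
          refine Finset.sum_congr rfl fun n _ => ?_
          simp [hf, Set.indicator_apply]
      _ ≤ ∑ n ∈ dyadicPrimes k, 1 / (2 : ℝ) ^ k := by
          refine Finset.sum_le_sum fun n hn => ?_
          have := (Finset.mem_Ico.1 (Finset.mem_filter.1 hn).1).1
          gcongr
          exact_mod_cast this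
      _ ≤ _ := by
          rw [Finset.sum_const, nsmul_eq_mul, mul_one_div, div_le_div_iff₀ (by positivity) hk0]
          linarith
  have hsum : ∀ M, ∑ n ∈ Finset.range (2 ^ (K + M)), f n ≤
      ∑ n ∈ Finset.range (2 ^ K), f n + ∑ k ∈ Finset.range M, 1 / ((k + K : ℕ) : ℝ) ^ 2 := by
    intro M
    induction M with
    | zero => simp
    | succ M ih =>
      have h1 := Finset.sum_range_add_sum_Ico f
        (show 2 ^ (K + M) ≤ 2 ^ (K + M + 1) from Nat.pow_le_pow_right (by norm_num) (by omega))
      rw [Finset.sum_range_succ, ← add_assoc K M 1, ← h1]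
      have := hblock (K + M) (by omega)
      rw [add_comm K M] at *
      linarith
  have hsummable : Summable f := by
    refine summable_of_sum_range_le (c := ∑ n ∈ Finset.range (2 ^ K), f n + ∑' k : ℕ, 1 / ((k + K : ℕ) : ℝ) ^ 2) hf0 fun n => ?_
    calc _ ≤ ∑ n ∈ Finset.range (2 ^ (K + n)), f n := by
          refine Finset.sum_le_sum_of_subset_of_nonneg ?_ (fun i _ _ => hf0 i)
          refine Finset.range_mono ?_
          exact (Nat.lt_two_pow_self).le.trans (Nat.pow_le_pow_right (by norm_num) (by omega))
      _ ≤ _ := hsum n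
      _ ≤ _ := by
          gcongr
          exact ((summable_nat_add_iff K).2 hs2).sum_le_tsum _ (fun _ _ => by positivity)
  exact not_summable_one_div_on_primes hsummable

lemma volume_Ico_inter_nearInt_le {κ t : ℝ} (hκ : 0 < κ) (hκ1 : κ ≤ 1) (ht : 0 < t) {n : ℕ}
    (hn : 0 < n) :
    volume (Ico (0 : ℝ) 1 ∩ nearInt κ t n) ≤ ENNReal.ofReal (8 * (n : ℝ) ^ (-t)) := by
  have hn' : (1 : ℝ) ≤ n := by exact_mod_cast hn
  have hpow : (n : ℝ) ^ (-t) ≤ 1 := Real.rpow_le_one_of_one_le_of_nonpos hn' (by linarith)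
  have hpow0 : 0 < (n : ℝ) ^ (-t) := by positivity
  set v : ℝ := κ * (n : ℝ) ^ (-t) with hv
  have hv1 : v ≤ 1 := by nlinarith
  calc _ ≤ volume (⋃ p ∈ Finset.Icc (0 : ℤ) n, (Ico (0 : ℝ) (0 + 1) ∩ {y | |(n : ℝ) * y - p| < v})) := by
        refine measure_mono ?_
        rintro y ⟨⟨hy0, hy1⟩, p, hp⟩
        have hp' := abs_lt.1 hp
        have h1 : (n : ℝ) * y ≤ n * 1 := by gcongr
        have h2 : 0 ≤ (n : ℝ) * y := by positivity
        have hl : -1 < p := by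
          have : (-1 : ℝ) < p := by linarith
          exact_mod_cast this
        have hu : p < n + 1 := by
          have : (p : ℝ) < n + 1 := by linarith
          exact_mod_cast this
        refine Set.mem_biUnion (x := p) ?_ ⟨⟨hy0, by linarith⟩, hp⟩
        exact Finset.mem_coe.2 (Finset.mem_Icc.2 ⟨by omega, by omega⟩)
    _ ≤ ∑ p ∈ Finset.Icc (0 : ℤ) n, ENNReal.ofReal (2 * v / n) := by
        refine (measure_biUnion_finset_le _ _).trans (Finset.sum_le_sum fun p _ => ?_)
        exact (volume_inter_near_le hn p).trans (ENNReal.ofReal_le_ofReal (min_le_right _ _))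
    _ = ENNReal.ofReal ((n + 1) * (2 * v / n)) := by
        rw [Finset.sum_const, nsmul_eq_mul, ENNReal.ofReal_mul (by positivity), Int.card_Icc]
        congr 1
        rw [show ((n : ℤ) + 1 - 0).toNat = n + 1 by omega]
        rw [← ENNReal.ofReal_natCast]; push_cast; rfl
    _ ≤ _ := by
        refine ENNReal.ofReal_le_ofReal ?_
        rw [← mul_div_assoc, div_le_iff₀ (by linarith), hv]
        have : κ * (n : ℝ) ^ (-t) ≤ 1 * (n : ℝ) ^ (-t) := by gcongr
        nlinarith

lemma volume_unitCube_inter_nearTail_le {m : ℕ} {κ : ℝ} {τ : Fin m → ℝ} (hκ : 0 < κ) (hκ1 : κ ≤ 1)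
    (hτ : ∀ i, 0 < τ i) (N : ℕ) :
    volume ((Set.univ.pi fun _ : Fin m => Ico (0 : ℝ) 1) ∩ nearTail κ τ N) ≤
      ENNReal.ofReal (8 ^ m) * zetaTail (∑ i, τ i) N := by
  rw [nearTail, inter_iUnion, zetaTail, ← ENNReal.tsum_mul_left]
  refine (measure_iUnion_le _).trans (ENNReal.tsum_le_tsum fun k => ?_)
  set n := k + (N + 1) with hn
  have hn0 : 0 < n := by omega
  have hn' : (0 : ℝ) < n := by exact_mod_cast hn0
  rw [nearRat, ← Set.pi_inter_distrib, volume_pi_pi]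
  calc _ ≤ ∏ i, ENNReal.ofReal (8 * (n : ℝ) ^ (-τ i)) :=
        Finset.prod_le_prod' fun i _ => volume_Ico_inter_nearInt_le hκ hκ1 (hτ i) hn0
    _ = ENNReal.ofReal (∏ i, (8 * (n : ℝ) ^ (-τ i))) := by
        rw [ENNReal.ofReal_prod_of_nonneg]
        intro i _
        positivity
    _ = _ := by
        rw [← ENNReal.ofReal_mul (by positivity)]
        congr 1
        rw [← Finset.sum_neg_distrib, Real.rpow_sum_of_pos hn', ← Fin.prod_const,
          ← Finset.prod_mul_distrib]

lemma rpow_mul_prod_min_le {m : ℕ} {τ : Fin m → ℝ} {s Q δ : ℝ} (hQ : 1 < Q) (hδ : 0 < δ)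
    (hδQ : δ ≤ 1 / Q)
    (hs : ∀ t : ℝ, 0 ≤ t → s * (1 + t) ≤ m + 1 + ∑ i, max 0 (t - τ i)) :
    Q ^ (-((m : ℝ) + 1)) * ∏ i, min 1 (δ * Q ^ (1 + τ i)) ≤ δ ^ s := by
  have hQ0 : 0 < Q := by linarith
  have hlQ : 0 < Real.log Q := Real.log_pos hQ
  obtain ⟨t, ht0, rfl⟩ : ∃ t : ℝ, 0 ≤ t ∧ δ = Q ^ (-(1 + t)) := by
    refine ⟨-(Real.log δ / Real.log Q) - 1, ?_, ?_⟩
    · have h1 : Real.log δ ≤ -Real.log Q := by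
        rw [← Real.log_inv, ← one_div]; exact Real.log_le_log hδ hδQ
      have : Real.log δ / Real.log Q ≤ -1 := by rw [div_le_iff₀ hlQ]; linarith
      linarith
    · rw [Real.rpow_def_of_pos hQ0]
      rw [show Real.log Q * -(1 + (-(Real.log δ / Real.log Q) - 1)) = Real.log δ by
        field_simp; ring, Real.exp_log hδ]
  have e : ∀ i, min 1 (Q ^ (-(1 + t)) * Q ^ (1 + τ i)) = Q ^ (-max 0 (t - τ i)) := by
    intro i
    rw [← Real.rpow_add hQ0, show -(1 + t) + (1 + τ i) = -(t - τ i) by ring]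
    rcases le_total 0 (t - τ i) with h | h
    · rw [max_eq_right h, min_eq_right]
      exact Real.rpow_le_one_of_one_le_of_nonpos hQ.le (by linarith)
    · rw [max_eq_left h, min_eq_left, neg_zero, Real.rpow_zero]
      exact Real.one_le_rpow hQ.le (by linarith)
  rw [Finset.prod_congr rfl fun i _ => e i, ← Real.rpow_sum_of_pos hQ0, ← Real.rpow_add hQ0,
    ← Real.rpow_mul hQ0.le, Finset.sum_neg_distrib]
  refine Real.rpow_le_rpow_of_exponent_le hQ.le ?_
  linarith [hs t ht0]

/-- Polynomial factors in `k` are absorbed by an arbitrarily small power of the scale `2 ^ (-k)`. -/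
lemma eventually_scale_absorb {s s₁ s₂ C₁ C₂ θ : ℝ} (h₁ : s < s₁) (h₂ : s < s₂) (hθ : 0 < θ) 
    (hC₁ : 0 ≤ C₁) (hC₂ : 0 ≤ C₂) :
    ∀ᶠ k : ℕ in Filter.atTop, ∀ δ : ℝ, 0 < δ → δ ≤ 1 / 2 ^ k →
      C₁ * (k : ℝ) ^ 2 * δ ^ s₁ + C₂ * k * δ ^ s₂ ≤ θ * δ ^ s := by
  have key : ∀ (u : ℝ) (j : ℕ) (C : ℝ), s < u → 0 ≤ C → ∀ᶠ k : ℕ in Filter.atTop, ∀ δ : ℝ, 0 < δ →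
      δ ≤ 1 / 2 ^ k → C * (k : ℝ) ^ j * δ ^ u ≤ θ / 2 * δ ^ s := by
    intro u j C hu hC
    have hr1 : (2 : ℝ) ^ (-(u - s)) < 1 := Real.rpow_lt_one_of_one_lt_of_neg (by norm_num) (by linarith)
    have hr0 : 0 ≤ (2 : ℝ) ^ (-(u - s)) := by positivity
    have ht := (tendsto_pow_const_mul_const_pow_of_lt_one j hr0 hr1).const_mul C
    rw [mul_zero] at ht
    filter_upwards [ht.eventually (gt_mem_nhds (half_pos hθ))] with k hk δ hδ hδk
    have h1 : δ ^ u = δ ^ (u - s) * δ ^ s := by rw [← Real.rpow_add hδ]; ring_nf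
    have h2 : δ ^ (u - s) ≤ ((2 : ℝ) ^ (-(u - s))) ^ k := by
      calc δ ^ (u - s) ≤ (1 / 2 ^ k : ℝ) ^ (u - s) := Real.rpow_le_rpow hδ.le hδk (by linarith)
        _ = _ := by
          rw [one_div, ← Real.rpow_natCast, ← Real.rpow_neg (by norm_num), ← Real.rpow_natCast,
            ← Real.rpow_mul (by norm_num), ← Real.rpow_mul (by norm_num)]
          ring_nf
    rw [h1]
    calc C * (k : ℝ) ^ j * (δ ^ (u - s) * δ ^ s)
        ≤ C * (k : ℝ) ^ j * (((2 : ℝ) ^ (-(u - s))) ^ k * δ ^ s) := by gcongr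
      _ = C * ((k : ℝ) ^ j * ((2 : ℝ) ^ (-(u - s))) ^ k) * δ ^ s := by ring
      _ ≤ _ := by gcongr
  filter_upwards [key s₁ 2 C₁ h₁ hC₁, key s₂ 1 C₂ h₂ hC₂] with k h1 h2 δ hδ hδk
  have := h1 δ hδ hδk
  have h3 := h2 δ hδ hδk
  rw [pow_one] at h3
  linarith

/-- The closed cube with lowest corner `b` and side length `r`. -/
def closedCube {m : ℕ} (b : Fin m → ℝ) (r : ℝ) : Set (Fin m → ℝ) :=
  Set.univ.pi fun i => Icc (b i) (b i + r)

/-- The half-open cube with lowest corner `b` and side length `r`. -/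
def icoCube {m : ℕ} (b : Fin m → ℝ) (r : ℝ) : Set (Fin m → ℝ) :=
  Set.univ.pi fun i => Ico (b i) (b i + r)

lemma volume_icoCube {m : ℕ} (b : Fin m → ℝ) {r : ℝ} (hr : 0 ≤ r) :
    volume (icoCube b r) = ENNReal.ofReal (r ^ m) := by
  rw [icoCube, Real.volume_pi_Ico]
  simp [ENNReal.ofReal_pow hr]

lemma measurableSet_icoCube {m : ℕ} (b : Fin m → ℝ) (r : ℝ) : MeasurableSet (icoCube b r) :=
  MeasurableSet.univ_pi fun _ => measurableSet_Ico

lemma measurableSet_nearTail {m : ℕ} (κ : ℝ) (τ : Fin m → ℝ) (N : ℕ) :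
    MeasurableSet (nearTail κ τ N) := by
  refine MeasurableSet.iUnion fun k => MeasurableSet.univ_pi fun i => IsOpen.measurableSet ?_
  have : nearInt κ (τ i) (k + (N + 1)) = ⋃ p : ℤ,
      {y : ℝ | |((k + (N + 1) : ℕ) : ℝ) * y - p| < κ * ((k + (N + 1) : ℕ) : ℝ) ^ (-τ i)} := by
    ext y; simp [nearInt]
  rw [this]
  exact isOpen_iUnion fun p => isOpen_lt (by fun_prop) continuous_const

/-- Offset of the cells from the rational point with denominator about `2 ^ k`. -/
def cellOffset {m : ℕ} (τ : Fin m → ℝ) (k : ℕ) (i : Fin m) : ℝ :=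
  (2 * 2 ^ k : ℝ) ^ (-(1 + τ i)) / 2

/-- Side length of the cells at scale `2 ^ k`. -/
def cellSide (T : ℝ) (k : ℕ) : ℝ := (2 * 2 ^ k : ℝ) ^ (-(1 + T)) / 2

/-- Number of cells in the `i`-th direction. -/
def cellCount {m : ℕ} (τ : Fin m → ℝ) (T : ℝ) (k : ℕ) (i : Fin m) : ℕ :=
  ⌊cellOffset τ k i / cellSide T k⌋₊

/-- The lowest corner of the `j`-th cell attached to the rational point `p / q`. -/
def cellCorner {m : ℕ} (τ : Fin m → ℝ) (T : ℝ) (k q : ℕ) (p : Fin m → ℤ) (j : Fin m → ℕ) :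
    Fin m → ℝ :=
  fun i => (p i : ℝ) / q + cellOffset τ k i + j i * cellSide T k

/-- The index set of the cells attached to a rational point. -/
def cellIndex {m : ℕ} (τ : Fin m → ℝ) (T : ℝ) (k : ℕ) : Finset (Fin m → ℕ) :=
  Fintype.piFinset fun i => Finset.range (cellCount τ T k i)

section cells

variable {m : ℕ} {τ : Fin m → ℝ} {T : ℝ} {k q : ℕ}

lemma cellOffset_pos (τ : Fin m → ℝ) (k : ℕ) (i : Fin m) : 0 < cellOffset τ k i := by
  unfold cellOffset; positivity

lemma cellSide_pos (T : ℝ) (k : ℕ) : 0 < cellSide T k := by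
  unfold cellSide; positivity

lemma one_lt_two_mul_two_pow (k : ℕ) : (1 : ℝ) < 2 * 2 ^ k := by
  have : (1 : ℝ) ≤ 2 ^ k := one_le_pow₀ (by norm_num)
  linarith

lemma cellSide_le_cellOffset {i : Fin m} (hT : τ i ≤ T) : cellSide T k ≤ cellOffset τ k i := by
  unfold cellSide cellOffset
  have := one_lt_two_mul_two_pow k
  gcongr
  exact this.le

lemma two_mul_rpow_le {t : ℝ} (ht : 0 < t) (k : ℕ) :
    (2 * 2 ^ k : ℝ) ^ (-(1 + t)) / 2 ≤ 1 / (4 * 2 ^ k) := by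
  have h := one_lt_two_mul_two_pow k
  have : (2 * 2 ^ k : ℝ) ^ (-(1 + t)) ≤ (2 * 2 ^ k : ℝ) ^ (-1 : ℝ) :=
    Real.rpow_le_rpow_of_exponent_le h.le (by linarith)
  rw [Real.rpow_neg_one] at this
  calc _ ≤ (2 * 2 ^ k : ℝ)⁻¹ / 2 := by gcongr
    _ = _ := by field_simp; norm_num

lemma cellOffset_le {i : Fin m} (hτ : 0 < τ i) : cellOffset τ k i ≤ 1 / (4 * 2 ^ k) :=
  two_mul_rpow_le hτ k

lemma cellSide_lt (hT : 0 < T) : cellSide T k < 1 / (4 * 2 ^ k) := by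
  have h := one_lt_two_mul_two_pow k
  have : (2 * 2 ^ k : ℝ) ^ (-(1 + T)) < (2 * 2 ^ k : ℝ) ^ (-1 : ℝ) :=
    Real.rpow_lt_rpow_of_exponent_lt h (by linarith)
  rw [Real.rpow_neg_one] at this
  calc cellSide T k < (2 * 2 ^ k : ℝ)⁻¹ / 2 := by unfold cellSide; gcongr
    _ = _ := by field_simp; norm_num

lemma cellCount_pos {i : Fin m} (hT : τ i ≤ T) : 0 < cellCount τ T k i := by
  refine Nat.floor_pos.2 ?_
  rw [one_le_div (cellSide_pos T k)]
  exact cellSide_le_cellOffset hT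

lemma cellCount_mul_le (τ : Fin m → ℝ) (T : ℝ) (k : ℕ) (i : Fin m) :
    cellCount τ T k i * cellSide T k ≤ cellOffset τ k i := by
  have h := Nat.floor_le (div_nonneg (cellOffset_pos τ k i).le (cellSide_pos T k).le)
  rwa [le_div_iff₀ (cellSide_pos T k)] at h

lemma cellOffset_le_two_mul {i : Fin m} (hT : τ i ≤ T) :
    cellOffset τ k i ≤ 2 * (cellCount τ T k i * cellSide T k) := by
  have h := Nat.lt_floor_add_one (cellOffset τ k i / cellSide T k)
  rw [div_lt_iff₀ (cellSide_pos T k)] at h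
  have h1 : (1 : ℝ) ≤ cellCount τ T k i := by exact_mod_cast cellCount_pos hT
  have := cellSide_pos T k
  change _ < ((cellCount τ T k i : ℝ) + 1) * _ at h
  nlinarith

lemma mem_dyadicPrimes : q ∈ dyadicPrimes k ↔ (2 ^ k ≤ q ∧ q < 2 ^ (k + 1)) ∧ q.Prime := by
  simp [dyadicPrimes]

lemma le_of_mem_dyadicPrimes (hq : q ∈ dyadicPrimes k) : (2 : ℝ) ^ k ≤ q := by
  exact_mod_cast (mem_dyadicPrimes.1 hq).1.1

lemma lt_of_mem_dyadicPrimes (hq : q ∈ dyadicPrimes k) : (q : ℝ) < 2 * 2 ^ k := by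
  have := (mem_dyadicPrimes.1 hq).1.2
  rw [pow_succ, mul_comm] at this
  exact_mod_cast this

lemma two_mul_cellOffset_mul_lt {i : Fin m} (hτ : 0 < τ i) (hq : q ∈ dyadicPrimes k) :
    q * (2 * cellOffset τ k i) < 1 := by
  have h1 := cellOffset_le (k := k) hτ
  have h2 := lt_of_mem_dyadicPrimes hq
  have h3 : (0 : ℝ) < 2 ^ k := by positivity
  have h4 := cellOffset_pos τ k i
  calc q * (2 * cellOffset τ k i) < (2 * 2 ^ k) * (2 * cellOffset τ k i) := by gcongr
    _ ≤ (2 * 2 ^ k) * (2 * (1 / (4 * 2 ^ k))) := by gcongr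
    _ = 1 := by field_simp; norm_num

lemma two_mul_cellOffset_mul_lt_rpow {i : Fin m} (hτ : 0 < τ i) (hq : q ∈ dyadicPrimes k) :
    q * (2 * cellOffset τ k i) < (q : ℝ) ^ (-τ i) := by
  have h2 := lt_of_mem_dyadicPrimes hq
  have hq0 : (0 : ℝ) < q := by exact_mod_cast (mem_dyadicPrimes.1 hq).2.pos
  have h : (2 * 2 ^ k : ℝ) ^ (-(1 + τ i)) < (q : ℝ) ^ (-(1 + τ i)) :=
    Real.rpow_lt_rpow_of_neg hq0 h2 (by linarith)
  calc q * (2 * cellOffset τ k i) = q * (2 * 2 ^ k : ℝ) ^ (-(1 + τ i)) := by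
        unfold cellOffset; ring
    _ < q * (q : ℝ) ^ (-(1 + τ i)) := by gcongr
    _ = (q : ℝ) ^ (1 : ℝ) * (q : ℝ) ^ (-(1 + τ i)) := by rw [Real.rpow_one]
    _ = _ := by rw [← Real.rpow_add hq0]; ring_nf

lemma mul_rpow_le_mul_cellOffset {κ : ℝ} {i : Fin m} (hτ : 0 < τ i) (hT : τ i ≤ T)
    (hκ : κ ≤ 2 ^ (-(2 + T))) (hq : q ∈ dyadicPrimes k) {n : ℕ} (hn : q ≤ n) :
    κ * (n : ℝ) ^ (-τ i) ≤ n * cellOffset τ k i := by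
  have h2 := le_of_mem_dyadicPrimes hq
  have h2' : (2 : ℝ) ^ k ≤ n := h2.trans (by exact_mod_cast hn)
  have h0 : (0 : ℝ) < 2 ^ k := by positivity
  have hn0 : (0 : ℝ) < n := by linarith
  have h : (2 * n : ℝ) ^ (-(1 + τ i)) ≤ (2 * 2 ^ k : ℝ) ^ (-(1 + τ i)) :=
    Real.rpow_le_rpow_of_nonpos (by positivity) (by linarith) (by linarith)
  have h3 : κ ≤ (2 : ℝ) ^ (-(2 + τ i)) :=
    hκ.trans (Real.rpow_le_rpow_of_exponent_le (by norm_num) (by linarith))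
  calc κ * (n : ℝ) ^ (-τ i) ≤ (2 : ℝ) ^ (-(2 + τ i)) * (n : ℝ) ^ (-τ i) := by gcongr
    _ = n * ((2 * n : ℝ) ^ (-(1 + τ i)) / 2) := by
        rw [Real.mul_rpow (by norm_num) hn0.le, show -(2 + τ i) = -(1 + τ i) - 1 by ring,
          Real.rpow_sub_one (by norm_num), show -τ i = -(1 + τ i) + 1 by ring,
          Real.rpow_add_one hn0.ne']
        ring
    _ ≤ _ := by unfold cellOffset; gcongr

lemma mem_cellIndex {j : Fin m → ℕ} : j ∈ cellIndex τ T k ↔ ∀ i, j i < cellCount τ T k i := by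
  simp [cellIndex]

lemma card_cellIndex (τ : Fin m → ℝ) (T : ℝ) (k : ℕ) :
    (cellIndex τ T k).card = ∏ i, cellCount τ T k i := by
  simp [cellIndex]

lemma cell_bounds {p : Fin m → ℤ} {j : Fin m → ℕ} (hj : j ∈ cellIndex τ T k)
    {x : Fin m → ℝ} (hx : x ∈ closedCube (cellCorner τ T k q p j) (cellSide T k)) (i : Fin m) :
    (p i : ℝ) / q + cellOffset τ k i ≤ x i ∧ x i ≤ (p i : ℝ) / q + 2 * cellOffset τ k i := by
  have h1 := hx i (mem_univ i)
  have h2 : ((j i : ℝ) + 1) ≤ cellCount τ T k i := by exact_mod_cast mem_cellIndex.1 hj i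
  have h3 := cellSide_pos T k
  have h4 := cellCount_mul_le τ T k i
  have h5 : ((j i : ℝ) + 1) * cellSide T k ≤ cellOffset τ k i :=
    (mul_le_mul_of_nonneg_right h2 h3.le).trans h4
  have h6 : (0 : ℝ) ≤ j i * cellSide T k := by positivity
  simp only [cellCorner] at h1
  constructor <;> linarith [h1.1, h1.2]

lemma icoCube_cell_subset_ratBox {p : Fin m → ℤ} {j : Fin m → ℕ} (hj : j ∈ cellIndex τ T k) :
    icoCube (cellCorner τ T k q p j) (cellSide T k) ⊆ ratBox (cellOffset τ k) q p := by
  intro x hx i _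
  have h1 := hx i (mem_univ i)
  have h2 : ((j i : ℝ) + 1) ≤ cellCount τ T k i := by exact_mod_cast mem_cellIndex.1 hj i
  have h3 := cellSide_pos T k
  have h4 := cellCount_mul_le τ T k i
  have h5 : ((j i : ℝ) + 1) * cellSide T k ≤ cellOffset τ k i :=
    (mul_le_mul_of_nonneg_right h2 h3.le).trans h4
  have h6 : (0 : ℝ) ≤ j i * cellSide T k := by positivity
  simp only [cellCorner] at h1
  constructor <;> linarith [h1.1, h1.2]

lemma abs_sub_lt_of_mem_cell (hτ : ∀ i, 0 < τ i) (hq : q ∈ dyadicPrimes k)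
    {p : Fin m → ℤ} {j : Fin m → ℕ} (hj : j ∈ cellIndex τ T k)
    {x : Fin m → ℝ} (hx : x ∈ closedCube (cellCorner τ T k q p j) (cellSide T k)) (i : Fin m) :
    |(q : ℝ) * x i - p i| < (q : ℝ) ^ (-τ i) := by
  obtain ⟨h1, h2⟩ := cell_bounds hj hx i
  have hq0 : (0 : ℝ) < q := by exact_mod_cast (mem_dyadicPrimes.1 hq).2.pos
  have h3 := two_mul_cellOffset_mul_lt_rpow (hτ i) hq
  have h4 := cellOffset_pos τ k i
  have e : (q : ℝ) * x i - p i = q * (x i - p i / q) := by field_simp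
  rw [e, abs_mul, abs_of_pos hq0, abs_of_nonneg (by linarith)]
  refine lt_of_le_of_lt ?_ h3
  gcongr
  linarith

lemma sum_volume_cell_le (τ : Fin m → ℝ) (T : ℝ) (k q : ℕ) (p : Fin m → ℤ)
    {Z : Set (Fin m → ℝ)} (hZ : MeasurableSet Z) :
    ∑ j ∈ cellIndex τ T k, volume (icoCube (cellCorner τ T k q p j) (cellSide T k) ∩ Z) ≤
      volume (ratBox (cellOffset τ k) q p ∩ Z) := by
  rw [← measure_biUnion_finset]
  · refine measure_mono (Set.iUnion₂_subset fun j hj => ?_)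
    exact inter_subset_inter_left _ (icoCube_cell_subset_ratBox hj)
  · intro j _ j' _ hne
    refine Set.disjoint_left.2 ?_
    rintro x ⟨hx, _⟩ ⟨hx', _⟩
    apply hne
    funext i
    have h1 := hx i (mem_univ i)
    have h2 := hx' i (mem_univ i)
    simp only [cellCorner] at h1 h2
    have h3 := cellSide_pos T k
    have h4 : (j i : ℝ) < j' i + 1 := by
      refine lt_of_mul_lt_mul_right ?_ h3.le
      linarith [h1.1, h2.2]
    have h5 : (j' i : ℝ) < j i + 1 := by
      refine lt_of_mul_lt_mul_right ?_ h3.le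
      linarith [h2.1, h1.2]
    have h4' : j i < j' i + 1 := by exact_mod_cast h4
    have h5' : j' i < j i + 1 := by exact_mod_cast h5
    omega
  · exact fun j _ => (measurableSet_icoCube _ _).inter hZ

end cells

/-- The numerators of the rational points with denominator `q` that lie in the interior of the unit
cube and whose `1 / q`-cube lies in the cube with lowest corner `b` and side length `r`. -/
def basePts {m : ℕ} (b : Fin m → ℝ) (r : ℝ) (q : ℕ) : Finset (Fin m → ℤ) :=
  (Fintype.piFinset fun _ : Fin m => Finset.Ico (1 : ℤ) q).filter
    fun p => ∀ i, b i ≤ (p i : ℝ) / q ∧ ((p i : ℝ) + 1) / q ≤ b i + r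

lemma card_basePts_ge {m : ℕ} {b : Fin m → ℝ} {r : ℝ} {q : ℕ} (hb : ∀ i, 0 ≤ b i)
    (hb1 : ∀ i, b i + r ≤ 1) (hq : 6 ≤ q * r) : (q * r / 2) ^ m ≤ ((basePts b r q).card : ℝ) := by
  have hq0 : (0 : ℝ) < q := by
    rcases Nat.eq_zero_or_pos q with h | h
    · subst h; norm_num at hq
    · exact_mod_cast h
  set F : Fin m → Finset ℤ := fun i => Finset.Icc (⌈(q : ℝ) * b i⌉ + 1) (⌊(q : ℝ) * (b i + r)⌋ - 1)
    with hF
  have hsub : Fintype.piFinset F ⊆ basePts b r q := by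
    intro p hp
    have hp' : ∀ i, ⌈(q : ℝ) * b i⌉ + 1 ≤ p i ∧ p i ≤ ⌊(q : ℝ) * (b i + r)⌋ - 1 := fun i => by
      simpa [hF] using Fintype.mem_piFinset.1 hp i
    refine Finset.mem_filter.2 ⟨Fintype.mem_piFinset.2 fun i => ?_, fun i => ?_⟩
    · have h1 : 0 ≤ ⌈(q : ℝ) * b i⌉ := Int.ceil_nonneg (by have := hb i; positivity)
      have h2 : ⌊(q : ℝ) * (b i + r)⌋ ≤ q := by
        have : (q : ℝ) * (b i + r) ≤ q := by nlinarith [hb1 i]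
        have := (Int.floor_mono this)
        simpa using this
      have := hp' i
      rw [Finset.mem_Ico]
      omega
    · have h1 := Int.le_ceil ((q : ℝ) * b i)
      have h2 := Int.floor_le ((q : ℝ) * (b i + r))
      have h3 : ((⌈(q : ℝ) * b i⌉ : ℝ) + 1) ≤ p i := by exact_mod_cast (hp' i).1
      have h4 : (p i : ℝ) ≤ ⌊(q : ℝ) * (b i + r)⌋ - 1 := by exact_mod_cast (hp' i).2
      rw [le_div_iff₀ hq0, div_le_iff₀ hq0]
      constructor <;> linarith
  have h1 : ∀ i, (q * r / 2 : ℝ) ≤ ((F i).card : ℝ) := by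
    intro i
    have h1 := Int.ceil_lt_add_one ((q : ℝ) * b i)
    have h2 := Int.lt_floor_add_one ((q : ℝ) * (b i + r))
    have h3 : ((⌊(q : ℝ) * (b i + r)⌋ - 1 + 1 - (⌈(q : ℝ) * b i⌉ + 1) : ℤ) : ℝ) ≤ (F i).card := by
      rw [hF]
      simp only [Int.card_Icc]
      exact_mod_cast Int.self_le_toNat _
    push_cast at h3
    linarith
  calc (q * r / 2) ^ m = ∏ _i : Fin m, (q * r / 2 : ℝ) := by
        rw [Finset.prod_const, Finset.card_univ, Fintype.card_fin]
    _ ≤ ∏ i, ((F i).card : ℝ) := Finset.prod_le_prod (fun _ _ => by linarith) fun i _ => h1 i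
    _ = ((Fintype.piFinset F).card : ℝ) := by rw [Fintype.card_piFinset]; push_cast; rfl
    _ ≤ _ := by exact_mod_cast Finset.card_le_card hsub

/-- `icoCube`s of side `1 / q` at distinct rational points with denominator `q` are disjoint. -/
lemma disjoint_icoCube_div {m q : ℕ} (hq : 0 < q) {p p' : Fin m → ℤ} (hne : p ≠ p') :
    Disjoint (icoCube (fun i => (p i : ℝ) / q) (1 / q)) (icoCube (fun i => (p' i : ℝ) / q) (1 / q)) := by
  refine Set.disjoint_left.2 fun x hx hx' => hne ?_
  have hq0 : (0 : ℝ) < q := by exact_mod_cast hq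
  funext i
  have h1 := hx i (mem_univ i)
  have h2 := hx' i (mem_univ i)
  simp only [mem_Ico, ← add_div, div_le_iff₀ hq0, lt_div_iff₀ hq0] at h1 h2
  have h3 : (p i : ℝ) < p' i + 1 := by linarith
  have h4 : (p' i : ℝ) < p i + 1 := by linarith
  have h3' : p i < p' i + 1 := by exact_mod_cast h3
  have h4' : p' i < p i + 1 := by exact_mod_cast h4
  omega

lemma card_meets_nearRat_le {m q N N' : ℕ} {τ b : Fin m → ℝ} {r c η : ℝ} (hq : 0 < q) (hr : 0 ≤ r)
    (hη : 0 ≤ η)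
    (hvol : volume (icoCube b r ∩ nearTail (2 * c) τ N) ≤ ENNReal.ofReal (η * r ^ m))
    (hN' : ∀ n : ℕ, 0 < n → n ≤ N' → ∀ i, (n : ℝ) / q ≤ c * (n : ℝ) ^ (-τ i))
    (F : Finset (Fin m → ℤ)) (hF : F ⊆ basePts b r q)
    (hmeet : ∀ p ∈ F, ∃ n, N < n ∧ n ≤ N' ∧
      (icoCube (fun i => (p i : ℝ) / q) (1 / q) ∩ nearRat c τ n).Nonempty) :
    (F.card : ℝ) ≤ η * (q * r) ^ m := by
  have hq0 : (0 : ℝ) < q := by exact_mod_cast hq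
  have hsub : ⋃ p ∈ F, icoCube (fun i => (p i : ℝ) / q) (1 / q) ⊆
      icoCube b r ∩ nearTail (2 * c) τ N := by
    refine Set.iUnion₂_subset fun p hp => ?_
    obtain ⟨n, hn, hn', y, hy, hyn⟩ := hmeet p hp
    have hb := (Finset.mem_filter.1 (hF hp)).2
    intro x hx
    refine ⟨fun i _ => ?_, mem_iUnion.2 ⟨n - (N + 1), ?_⟩⟩
    · have h1 := hx i (mem_univ i)
      have h2 := hb i
      rw [add_div] at h2
      exact ⟨h2.1.trans h1.1, h1.2.trans_le h2.2⟩
    · rw [Nat.sub_add_cancel hn]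
      intro i _
      obtain ⟨P, hP⟩ := hyn i (mem_univ i)
      refine ⟨P, ?_⟩
      have h1 := hx i (mem_univ i)
      have h2 := hy i (mem_univ i)
      have h3 := hN' n (by omega) hn' i
      have h4 : |x i - y i| ≤ 1 / q := by
        rw [abs_le]; constructor <;> linarith [h1.1, h1.2, h2.1, h2.2]
      calc |(n : ℝ) * x i - P| = |n * (x i - y i) + (n * y i - P)| := by ring_nf
        _ ≤ n * |x i - y i| + |n * y i - P| := by
            refine (abs_add_le _ _).trans ?_
            rw [abs_mul, Nat.abs_cast]
        _ < n * (1 / q) + c * (n : ℝ) ^ (-τ i) := by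
            refine add_lt_add_of_le_of_lt ?_ hP
            gcongr
        _ ≤ _ := by rw [mul_one_div]; linarith
  have h1 : (F.card : ENNReal) * ENNReal.ofReal ((1 / q) ^ m) ≤ ENNReal.ofReal (η * r ^ m) := by
    refine le_trans (le_of_eq ?_) ((measure_mono hsub).trans hvol)
    rw [measure_biUnion_finset (fun p _ p' _ hne => disjoint_icoCube_div hq hne)
      fun p _ => measurableSet_icoCube _ _]
    simp_rw [volume_icoCube _ (by positivity : (0 : ℝ) ≤ 1 / q)]
    simp
  rw [← ENNReal.ofReal_natCast, ← ENNReal.ofReal_mul (by positivity),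
    ENNReal.ofReal_le_ofReal_iff (by positivity)] at h1
  rw [div_pow, one_pow, mul_one_div, div_le_iff₀ (by positivity)] at h1
  rw [mul_pow]
  linarith

lemma card_cells_nearTail_le {m k q N : ℕ} {τ : Fin m → ℝ} {T κ η t : ℝ} (hτ : ∀ i, 0 < τ i)
    (hT : ∀ i, τ i ≤ T) (hκ : 0 < κ) (hκT : κ ≤ 2 ^ (-(2 + T))) (hq : q ∈ dyadicPrimes k)
    (ht : 0 ≤ t) (htail : zetaTail (∑ i, τ i) N ≤ ENNReal.ofReal t)
    (F : Finset ((Fin m → ℤ) × (Fin m → ℕ)))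
    (hF : F ⊆ (Fintype.piFinset fun _ : Fin m => Finset.Ico (1 : ℤ) q) ×ˢ cellIndex τ T k)
    (hvol : ∀ x ∈ F, ENNReal.ofReal (η * cellSide T k ^ m) ≤
      volume (icoCube (cellCorner τ T k q x.1 x.2) (cellSide T k) ∩ nearTail κ τ N)) :
    η * F.card ≤ (20 * κ * q) ^ m * t * (cellIndex τ T k).card := by
  have hs := cellSide_pos T k
  have h1 : (F.card : ENNReal) * ENNReal.ofReal (η * cellSide T k ^ m) ≤
      ENNReal.ofReal ((10 * κ * q) ^ m * (∏ i, cellOffset τ k i)) * zetaTail (∑ i, τ i) N := by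
    calc (F.card : ENNReal) * ENNReal.ofReal (η * cellSide T k ^ m)
        = ∑ x ∈ F, ENNReal.ofReal (η * cellSide T k ^ m) := by simp
      _ ≤ ∑ x ∈ F, volume (icoCube (cellCorner τ T k q x.1 x.2) (cellSide T k) ∩ nearTail κ τ N) :=
          Finset.sum_le_sum hvol
      _ ≤ ∑ x ∈ (Fintype.piFinset fun _ : Fin m => Finset.Ico (1 : ℤ) q) ×ˢ cellIndex τ T k,
            volume (icoCube (cellCorner τ T k q x.1 x.2) (cellSide T k) ∩ nearTail κ τ N) :=
          Finset.sum_le_sum_of_subset hF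
      _ = ∑ p ∈ Fintype.piFinset (fun _ : Fin m => Finset.Ico (1 : ℤ) q), ∑ j ∈ cellIndex τ T k,
            volume (icoCube (cellCorner τ T k q p j) (cellSide T k) ∩ nearTail κ τ N) :=
          Finset.sum_product _ _ _
      _ ≤ ∑ p ∈ Fintype.piFinset (fun _ : Fin m => Finset.Ico (1 : ℤ) q),
            volume (ratBox (cellOffset τ k) q p ∩ nearTail κ τ N) :=
          Finset.sum_le_sum fun p _ => sum_volume_cell_le τ T k q p (measurableSet_nearTail κ τ N)
      _ ≤ _ := sum_volume_nearTail_le (mem_dyadicPrimes.1 hq).2 N (cellOffset_pos τ k) hκ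
          fun n hn i => mul_rpow_le_mul_cellOffset (hτ i) (hT i) hκT hq hn
  have h2 : ∏ i, cellOffset τ k i ≤ ∏ i, (2 * cellSide T k) * (cellCount τ T k i : ℝ) :=
    Finset.prod_le_prod (fun i _ => (cellOffset_pos τ k i).le) fun i _ =>
      (cellOffset_le_two_mul (hT i)).trans (le_of_eq (by ring))
  have h3 : (F.card : ENNReal) * ENNReal.ofReal (η * cellSide T k ^ m) ≤
      ENNReal.ofReal ((10 * κ * q) ^ m * (∏ i, (2 * cellSide T k) * (cellCount τ T k i : ℝ))) *
        ENNReal.ofReal t := by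
    refine h1.trans ?_
    gcongr
  rw [← ENNReal.ofReal_natCast, ← ENNReal.ofReal_mul (by positivity),
    ← ENNReal.ofReal_mul (by positivity), ENNReal.ofReal_le_ofReal_iff (by positivity),
    Finset.prod_mul_distrib] at h3
  rw [card_cellIndex]
  push_cast
  simp only [Finset.prod_const, Finset.card_univ, Fintype.card_fin] at h3
  refine le_of_mul_le_mul_right ?_ (pow_pos hs m)
  calc _ = (F.card : ℝ) * (η * cellSide T k ^ m) := by ring
    _ ≤ _ := h3
    _ = _ := by
      rw [show (20 * κ * q : ℝ) = (10 * κ * q) * 2 by ring, mul_pow (10 * κ * q) 2, mul_pow 2]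
      ring

/-- The rational points with denominators in `P` other than `q` that are `l`-close to `p / q`. -/
def closePts {m : ℕ} (P : Finset ℕ) (l : Fin m → ℝ) (q : ℕ) (p : Fin m → ℤ) :
    Finset ((_ : ℕ) × (Fin m → ℤ)) :=
  (P.erase q).sigma fun q' =>
    (Fintype.piFinset fun _ : Fin m => Finset.Ico (1 : ℤ) q').filter
      fun p' => ∀ i, |(p i : ℝ) / q - (p' i : ℝ) / q'| < l i

lemma sum_card_close_le {m q q' : ℕ} (hq : q.Prime) (hq' : q'.Prime) (hne : q ≠ q')
    {l : Fin m → ℝ} (hl : ∀ i, 0 ≤ l i) :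
    ∑ p ∈ Fintype.piFinset (fun _ : Fin m => Finset.Ico (1 : ℤ) q),
      (((Fintype.piFinset fun _ : Fin m => Finset.Ico (1 : ℤ) q').filter
        fun p' => ∀ i, |(p i : ℝ) / q - (p' i : ℝ) / q'| < l i).card : ℝ) ≤
      ∏ i, (2 * (q * (q' * l i))) := by
  have hq0 : (0 : ℝ) < q := by exact_mod_cast hq.pos
  have hq0' : (0 : ℝ) < q' := by exact_mod_cast hq'.pos
  set F : Fin m → Finset (ℤ × ℤ) := fun i =>
    (Finset.Ico (1 : ℤ) q ×ˢ Finset.Ico (1 : ℤ) q').filter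
      fun x => |(x.1 : ℝ) / q - (x.2 : ℝ) / q'| < l i with hF
  have h1 : ∀ i, ((F i).card : ℝ) ≤ 2 * (q * (q' * l i)) := by
    intro i
    refine card_pairs_le hq q' (mul_nonneg hq0'.le (hl i)) (F i) fun x hx => ?_
    obtain ⟨hx1, hx2⟩ := Finset.mem_filter.1 hx
    obtain ⟨hxa, hxb⟩ := Finset.mem_product.1 hx1
    refine ⟨hxa, fun h0 => ?_, ?_⟩
    · have hd : (q : ℤ) ∣ q' * x.1 := ⟨x.2, by linarith⟩
      have hp : Prime (q : ℤ) := Nat.prime_iff_prime_int.1 hq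
      rcases hp.dvd_mul.1 hd with h | h
      · exact hne ((Nat.prime_dvd_prime_iff_eq hq hq').1 (Int.natCast_dvd_natCast.1 h))
      · rw [Finset.mem_Ico] at hxa
        have := Int.le_of_dvd (by linarith) h
        linarith
    · have e : (q' : ℝ) * x.1 - q * x.2 = (q * q') * ((x.1 : ℝ) / q - (x.2 : ℝ) / q') := by
        field_simp
      rw [e, abs_mul, abs_of_pos (by positivity), ← mul_assoc]
      gcongr
  rw [← Nat.cast_sum, ← Finset.card_sigma]
  calc _ ≤ ((Fintype.piFinset F).card : ℝ) := by
        refine Nat.cast_le.2 (Finset.card_le_card_of_injOn (fun x i => (x.1 i, x.2 i)) ?_ ?_)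
        · intro x hx
          obtain ⟨ha, hb⟩ := Finset.mem_sigma.1 hx
          obtain ⟨hb, hc⟩ := Finset.mem_filter.1 hb
          refine Finset.mem_coe.2 (Fintype.mem_piFinset.2 fun i => Finset.mem_filter.2
            ⟨Finset.mem_product.2 ⟨Fintype.mem_piFinset.1 ha i, Fintype.mem_piFinset.1 hb i⟩, hc i⟩)
        · rintro ⟨x1, x2⟩ _ ⟨y1, y2⟩ _ hxy
          have h1 : x1 = y1 := funext fun i => (Prod.ext_iff.1 (congrFun hxy i)).1
          have h2 : x2 = y2 := funext fun i => (Prod.ext_iff.1 (congrFun hxy i)).2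
          subst h1 h2
          rfl
    _ = ∏ i, ((F i).card : ℝ) := by rw [Fintype.card_piFinset]; push_cast; rfl
    _ ≤ _ := Finset.prod_le_prod (fun _ _ => by positivity) fun i _ => h1 i

lemma sum_card_closePts_le {m k : ℕ} {l : Fin m → ℝ} (hl : ∀ i, 0 ≤ l i) :
    ∑ x ∈ (dyadicPrimes k).sigma (fun q => Fintype.piFinset fun _ : Fin m => Finset.Ico (1 : ℤ) q),
      ((closePts (dyadicPrimes k) l x.1 x.2).card : ℝ) ≤
      (dyadicPrimes k).card ^ 2 * ((8 * (2 ^ k) ^ 2) ^ m * ∏ i, l i) := by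
  have hB : ∀ q ∈ dyadicPrimes k, ∀ q' ∈ (dyadicPrimes k).erase q,
      ∑ p ∈ Fintype.piFinset (fun _ : Fin m => Finset.Ico (1 : ℤ) q),
      (((Fintype.piFinset fun _ : Fin m => Finset.Ico (1 : ℤ) q').filter
        fun p' => ∀ i, |(p i : ℝ) / q - (p' i : ℝ) / q'| < l i).card : ℝ) ≤
      (8 * (2 ^ k) ^ 2) ^ m * ∏ i, l i := by
    intro q hq q' hq'
    obtain ⟨hne, hq'⟩ := Finset.mem_erase.1 hq'
    refine (sum_card_close_le (mem_dyadicPrimes.1 hq).2 (mem_dyadicPrimes.1 hq').2 hne.symm hl).trans ?_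
    have e : (8 * (2 ^ k) ^ 2) ^ m * ∏ i, l i = ∏ i : Fin m, (8 * (2 ^ k : ℝ) ^ 2) * l i := by
      rw [Finset.prod_mul_distrib]; simp
    rw [e]
    refine Finset.prod_le_prod (fun i _ => by have := hl i; positivity) fun i _ => ?_
    have h1 := lt_of_mem_dyadicPrimes hq
    have h2 := lt_of_mem_dyadicPrimes hq'
    calc (2 * (q * (q' * l i)) : ℝ) = 2 * (q * q') * l i := by ring
      _ ≤ 2 * ((2 * 2 ^ k) * (2 * 2 ^ k)) * l i := by
          have := hl i
          gcongr
      _ = _ := by ring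
  have hprod : 0 ≤ ∏ i, l i := Finset.prod_nonneg fun i _ => hl i
  rw [Finset.sum_sigma]
  calc _ = ∑ q ∈ dyadicPrimes k, ∑ q' ∈ (dyadicPrimes k).erase q,
      ∑ p ∈ Fintype.piFinset (fun _ : Fin m => Finset.Ico (1 : ℤ) q),
      (((Fintype.piFinset fun _ : Fin m => Finset.Ico (1 : ℤ) q').filter
        fun p' => ∀ i, |(p i : ℝ) / q - (p' i : ℝ) / q'| < l i).card : ℝ) := by
        refine Finset.sum_congr rfl fun q _ => ?_
        rw [Finset.sum_comm]
        refine Finset.sum_congr rfl fun p _ => ?_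
        rw [closePts, Finset.card_sigma]
        push_cast
        rfl
    _ ≤ ∑ q ∈ dyadicPrimes k, ∑ q' ∈ dyadicPrimes k, (8 * (2 ^ k) ^ 2) ^ m * ∏ i, l i := by
        refine Finset.sum_le_sum fun q hq => (Finset.sum_le_sum (hB q hq)).trans ?_
        exact Finset.sum_le_sum_of_subset_of_nonneg (Finset.erase_subset _ _)
          fun _ _ _ => by positivity
    _ = _ := by simp; ring

/-- The cells at scale `2 ^ k` inside the cube with lowest corner `b` and side length `r`,
each given by a denominator, a numerator vector and a cell index. -/
def cellsIn {m : ℕ} (τ : Fin m → ℝ) (T : ℝ) (k : ℕ) (b : Fin m → ℝ) (r : ℝ) :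
    Finset (((_ : ℕ) × (Fin m → ℤ)) × (Fin m → ℕ)) :=
  ((dyadicPrimes k).sigma (basePts b r)) ×ˢ cellIndex τ T k

/-- The closed cell with the given label. -/
def closedCell {m : ℕ} (τ : Fin m → ℝ) (T : ℝ) (k : ℕ)
    (x : ((_ : ℕ) × (Fin m → ℤ)) × (Fin m → ℕ)) : Set (Fin m → ℝ) :=
  closedCube (cellCorner τ T k x.1.1 x.1.2 x.2) (cellSide T k)

/-- The closeness thresholds used to separate rational points at the dyadic scale `g`. -/
def closeRadius {m : ℕ} (τ : Fin m → ℝ) (k g : ℕ) (i : Fin m) : ℝ :=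
  2 * ((1 / 2) ^ g / 2 ^ k + cellOffset τ k i)

lemma closeRadius_pos {m : ℕ} (τ : Fin m → ℝ) (k g : ℕ) (i : Fin m) : 0 < closeRadius τ k g i := by
  have := cellOffset_pos τ k i
  unfold closeRadius
  positivity

/-- The number of close rational points allowed at the dyadic scale `g`. -/
def closeBound {m : ℕ} (τ : Fin m → ℝ) (k G : ℕ) (r : ℝ) (g : ℕ) : ℝ :=
  8 * G * (dyadicPrimes k).card * (8 * (2 ^ k) ^ 2) ^ m * (∏ i, closeRadius τ k g i) /
    (2 ^ k * r / 2) ^ m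

lemma card_crowded_le {m k G : ℕ} {τ b : Fin m → ℝ} {r : ℝ} (hr : 0 < r)
    (hP : 0 < (dyadicPrimes k).card)
    (F : Finset ((_ : ℕ) × (Fin m → ℤ))) (hF : F ⊆ (dyadicPrimes k).sigma (basePts b r))
    (h : ∀ x ∈ F, ∃ g ∈ Finset.range G, closeBound τ k G r g <
      (closePts (dyadicPrimes k) (closeRadius τ k g) x.1 x.2).card) :
    (F.card : ℝ) ≤ (dyadicPrimes k).card * (2 ^ k * r / 2) ^ m / 8 := by
  classical
  have hP' : (0 : ℝ) < (dyadicPrimes k).card := by exact_mod_cast hP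
  have hY : (0 : ℝ) < (2 ^ k * r / 2) ^ m := by positivity
  rcases Nat.eq_zero_or_pos G with hG | hG
  · subst hG
    have : F = ∅ := Finset.eq_empty_of_forall_notMem fun x hx => by simpa using h x hx
    subst this
    simp only [Finset.card_empty, Nat.cast_zero]
    positivity
  have hG' : (0 : ℝ) < G := by exact_mod_cast hG
  set B : ℕ → Finset ((_ : ℕ) × (Fin m → ℤ)) := fun g => F.filter fun x => closeBound τ k G r g <
      (closePts (dyadicPrimes k) (closeRadius τ k g) x.1 x.2).card with hB
  have hsub : F ⊆ (Finset.range G).biUnion B := fun x hx => by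
    obtain ⟨g, hg, hg'⟩ := h x hx
    exact Finset.mem_biUnion.2 ⟨g, hg, Finset.mem_filter.2 ⟨hx, hg'⟩⟩
  have h1 : ∀ g, ((B g).card : ℝ) ≤ (dyadicPrimes k).card * (2 ^ k * r / 2) ^ m / (8 * G) := by
    intro g
    have hl : 0 < ∏ i, closeRadius τ k g i := Finset.prod_pos fun i _ => closeRadius_pos τ k g i
    have h2 : (B g).card * closeBound τ k G r g ≤
        (dyadicPrimes k).card ^ 2 * ((8 * (2 ^ k) ^ 2) ^ m * ∏ i, closeRadius τ k g i) := by
      refine le_trans ?_ (sum_card_closePts_le fun i => (closeRadius_pos τ k g i).le)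
      calc (B g).card * closeBound τ k G r g = ∑ x ∈ B g, closeBound τ k G r g := by simp
        _ ≤ ∑ x ∈ B g, ((closePts (dyadicPrimes k) (closeRadius τ k g) x.1 x.2).card : ℝ) :=
            Finset.sum_le_sum fun x hx => (Finset.mem_filter.1 hx).2.le
        _ ≤ _ := by
            refine Finset.sum_le_sum_of_subset_of_nonneg (fun x hx => ?_) fun _ _ _ => by positivity
            obtain ⟨ha, hb⟩ := Finset.mem_sigma.1 (hF (Finset.mem_filter.1 hx).1)
            exact Finset.mem_sigma.2 ⟨ha, (Finset.mem_filter.1 hb).1⟩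
    rw [closeBound] at h2
    rw [le_div_iff₀ (by positivity)]
    refine le_of_mul_le_mul_right ?_
      (by positivity : 0 < (dyadicPrimes k).card * ((8 * (2 ^ k : ℝ) ^ 2) ^ m * ∏ i, closeRadius τ k g i))
    rw [← mul_div_assoc, div_le_iff₀ hY] at h2
    linarith
  calc (F.card : ℝ) ≤ ∑ g ∈ Finset.range G, ((B g).card : ℝ) := by
        exact_mod_cast (Finset.card_le_card hsub).trans Finset.card_biUnion_le
    _ ≤ ∑ g ∈ Finset.range G, ((dyadicPrimes k).card * (2 ^ k * r / 2) ^ m / (8 * G) : ℝ) :=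
        Finset.sum_le_sum fun g _ => h1 g
    _ = _ := by simp; field_simp

lemma exists_good_cells {m k G N N' : ℕ} {τ b : Fin m → ℝ} {T r c t η : ℝ}
    (hτ : ∀ i, 0 < τ i) (hT : ∀ i, τ i ≤ T) (hc : 0 < c) (hcT : 2 * c ≤ 2 ^ (-(2 + T)))
    (hr : 0 < r) (hb : ∀ i, 0 ≤ b i) (hb1 : ∀ i, b i + r ≤ 1) (hη : η = (1 / 4) ^ m / 8)
    (hvol : volume (icoCube b r ∩ nearTail (2 * c) τ N) ≤ ENNReal.ofReal (η * r ^ m))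
    (hP : 0 < (dyadicPrimes k).card) (hk : 6 ≤ 2 ^ k * r)
    (hN' : ∀ n : ℕ, 0 < n → n ≤ N' → ∀ i, (n : ℝ) / 2 ^ k ≤ c * (n : ℝ) ^ (-τ i))
    (ht : 0 ≤ t) (htail : zetaTail (∑ i, τ i) N' ≤ ENNReal.ofReal t)
    (htη : (80 * c) ^ m * t ≤ η / 8 * (r / 2) ^ m) :
    ∃ F ⊆ cellsIn τ T k b r,
      (∀ x ∈ F, ∀ n, N < n → n ≤ N' → Disjoint (closedCell τ T k x) (nearRat c τ n)) ∧
      (∀ x ∈ F, volume (icoCube (cellCorner τ T k x.1.1 x.1.2 x.2) (cellSide T k) ∩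
        nearTail (2 * c) τ N') ≤ ENNReal.ofReal (η * cellSide T k ^ m)) ∧
      (∀ x ∈ F, ∀ g < G, ((closePts (dyadicPrimes k) (closeRadius τ k g) x.1.1 x.1.2).card : ℝ) ≤
        closeBound τ k G r g) ∧
      (dyadicPrimes k).card * (2 ^ k * r / 2) ^ m * (cellIndex τ T k).card ≤ 2 * (F.card : ℝ) := by
  classical
  have hη0 : 0 < η := by rw [hη]; positivity
  set P := dyadicPrimes k with hPdef
  set Y : ℝ := (2 ^ k * r / 2) ^ m with hY
  have hY0 : 0 < Y := by positivity
  set J : ℝ := ((cellIndex τ T k).card : ℝ) with hJ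
  set S := P.sigma (basePts b r) with hS
  set A := S.filter fun x => ∃ n, N < n ∧ n ≤ N' ∧
      (icoCube (fun i => (x.2 i : ℝ) / x.1) (1 / x.1) ∩ nearRat c τ n).Nonempty with hA
  set E := S.filter fun x => ∃ g ∈ Finset.range G, closeBound τ k G r g <
      (closePts (dyadicPrimes k) (closeRadius τ k g) x.1 x.2).card with hE
  set C := (cellsIn τ T k b r).filter fun x => ENNReal.ofReal (η * cellSide T k ^ m) <
    volume (icoCube (cellCorner τ T k x.1.1 x.1.2 x.2) (cellSide T k) ∩
        nearTail (2 * c) τ N') with hC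
  have hq0 : ∀ q ∈ P, (0 : ℝ) < q := fun q hq => by exact_mod_cast (mem_dyadicPrimes.1 hq).2.pos
  have hScard : P.card * Y ≤ (S.card : ℝ) := by
    rw [hS, Finset.card_sigma]
    push_cast
    rw [← nsmul_eq_mul, ← Finset.sum_const]
    refine Finset.sum_le_sum fun q hq => ?_
    have h1 := le_of_mem_dyadicPrimes hq
    have h2 : 2 ^ k * r ≤ q * r := by gcongr
    refine le_trans ?_ (card_basePts_ge hb hb1 (hk.trans h2))
    rw [hY]
    gcongr
  have hAcard : (A.card : ℝ) ≤ P.card * Y / 8 := by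
    have e : A = P.sigma fun q => (basePts b r q).filter fun p => ∃ n, N < n ∧ n ≤ N' ∧
        (icoCube (fun i => (p i : ℝ) / q) (1 / q) ∩ nearRat c τ n).Nonempty := by
      ext x
      simp only [hA, hS, Finset.mem_filter, Finset.mem_sigma, and_assoc]
    rw [e, Finset.card_sigma]
    push_cast
    rw [mul_div_assoc, ← nsmul_eq_mul, ← Finset.sum_const]
    refine Finset.sum_le_sum fun q hq => ?_
    have h1 := le_of_mem_dyadicPrimes hq
    have h2 := lt_of_mem_dyadicPrimes hq
    refine (card_meets_nearRat_le (mem_dyadicPrimes.1 hq).2.pos hr.le hη0.le hvol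
      (fun n hn hn' i => ?_) _ (Finset.filter_subset _ _)
      fun p hp => (Finset.mem_filter.1 hp).2).trans ?_
    · refine le_trans ?_ (hN' n hn hn' i)
      gcongr
    · calc η * (q * r) ^ m ≤ η * (2 * 2 ^ k * r) ^ m := by gcongr
        _ = _ := by
          rw [hη, hY, show (2 * 2 ^ k * r : ℝ) = 4 * (2 ^ k * r / 2) by ring, mul_pow, div_pow,
            one_pow]
          field_simp
  have hEcard : (E.card : ℝ) ≤ P.card * Y / 8 :=
    card_crowded_le hr hP E (Finset.filter_subset _ _) fun x hx => (Finset.mem_filter.1 hx).2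
  have hCcard : (C.card : ℝ) ≤ P.card * Y * J / 8 := by
    have h1 : ∀ q ∈ P, (((basePts b r q ×ˢ cellIndex τ T k).filter fun x =>
        ENNReal.ofReal (η * cellSide T k ^ m) <
        volume (icoCube (cellCorner τ T k q x.1 x.2) (cellSide T k) ∩
        nearTail (2 * c) τ N')).card : ℝ) ≤ Y * J / 8 := by
      intro q hq
      have h := card_cells_nearTail_le hτ hT (by positivity) hcT hq ht htail
        ((basePts b r q ×ˢ cellIndex τ T k).filter fun x =>
        ENNReal.ofReal (η * cellSide T k ^ m) <
        volume (icoCube (cellCorner τ T k q x.1 x.2) (cellSide T k) ∩ nearTail (2 * c) τ N'))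
        ((Finset.filter_subset _ _).trans (Finset.product_subset_product_left
          (Finset.filter_subset _ _))) fun x hx => (Finset.mem_filter.1 hx).2.le
      refine le_of_mul_le_mul_left (h.trans ?_) hη0
      have h2 := (lt_of_mem_dyadicPrimes hq).le
      calc (20 * (2 * c) * q) ^ m * t * J ≤ (20 * (2 * c) * (2 * 2 ^ k)) ^ m * t * J := by gcongr
        _ = (2 ^ k) ^ m * ((80 * c) ^ m * t) * J := by
          rw [show (20 * (2 * c) * (2 * 2 ^ k) : ℝ) = 2 ^ k * (80 * c) by ring, mul_pow]; ring
        _ ≤ (2 ^ k) ^ m * (η / 8 * (r / 2) ^ m) * J := by gcongr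
        _ = η * (Y * J / 8) := by
          rw [hY, show (2 ^ k * r / 2 : ℝ) = 2 ^ k * (r / 2) by ring, mul_pow]; ring
    calc (C.card : ℝ) ≤ ((P.sigma fun q => (basePts b r q ×ˢ cellIndex τ T k).filter fun x =>
        ENNReal.ofReal (η * cellSide T k ^ m) <
        volume (icoCube (cellCorner τ T k q x.1 x.2) (cellSide T k) ∩
        nearTail (2 * c) τ N')).card : ℝ) := by
          refine Nat.cast_le.2 (Finset.card_le_card_of_injOn (fun x => ⟨x.1.1, x.1.2, x.2⟩) ?_ ?_)
          · intro x hx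
            obtain ⟨hx1, hx2⟩ := Finset.mem_filter.1 hx
            obtain ⟨hx3, hx4⟩ := Finset.mem_product.1 hx1
            obtain ⟨hx5, hx6⟩ := Finset.mem_sigma.1 hx3
            exact Finset.mem_coe.2 (Finset.mem_sigma.2 ⟨hx5, Finset.mem_filter.2
              ⟨Finset.mem_product.2 ⟨hx6, hx4⟩, hx2⟩⟩)
          · rintro ⟨⟨q, p⟩, j⟩ _ ⟨⟨q', p'⟩, j'⟩ _ h
            simp only [Sigma.mk.injEq, heq_eq_eq, Prod.mk.injEq] at h
            obtain ⟨rfl, rfl, rfl⟩ := h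
            rfl
      _ ≤ ∑ q ∈ P, Y * J / 8 := by
          rw [Finset.card_sigma]
          push_cast
          exact Finset.sum_le_sum h1
      _ = _ := by rw [Finset.sum_const, nsmul_eq_mul]; ring
  refine ⟨((S \ (A ∪ E)) ×ˢ cellIndex τ T k) \ C, ?_, ?_, ?_, ?_, ?_⟩
  · exact Finset.sdiff_subset.trans (Finset.product_subset_product_left Finset.sdiff_subset)
  · intro x hx n hn hn'
    obtain ⟨hx1, _⟩ := Finset.mem_sdiff.1 hx
    obtain ⟨hx3, hx4⟩ := Finset.mem_product.1 hx1
    obtain ⟨hx5, hx6⟩ := Finset.mem_sdiff.1 hx3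
    have hx7 : x.1 ∉ A := fun h => hx6 (Finset.mem_union_left _ h)
    have hq := (Finset.mem_sigma.1 hx5).1
    refine Set.disjoint_left.2 fun y hy hyn => hx7 (Finset.mem_filter.2 ⟨hx5, n, hn, hn', y, ?_, hyn⟩)
    intro i _
    obtain ⟨h1, h2⟩ := cell_bounds hx4 hy i
    have h3 := two_mul_cellOffset_mul_lt (hτ i) hq
    have h4 := cellOffset_pos τ k i
    have h5 : 2 * cellOffset τ k i < 1 / x.1.1 := by
      rw [lt_div_iff₀ (hq0 _ hq)]; linarith
    constructor <;> linarith
  · intro x hx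
    obtain ⟨hx1, hx2⟩ := Finset.mem_sdiff.1 hx
    obtain ⟨hx3, hx4⟩ := Finset.mem_product.1 hx1
    refine not_lt.1 fun h => hx2 (Finset.mem_filter.2 ⟨Finset.mem_product.2
      ⟨(Finset.mem_sdiff.1 hx3).1, hx4⟩, h⟩)
  · intro x hx g hg
    obtain ⟨hx1, _⟩ := Finset.mem_sdiff.1 hx
    obtain ⟨hx3, hx4⟩ := Finset.mem_product.1 hx1
    obtain ⟨hx5, hx6⟩ := Finset.mem_sdiff.1 hx3
    refine not_lt.1 fun h => hx6 (Finset.mem_union_right _ (Finset.mem_filter.2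
      ⟨hx5, g, Finset.mem_range.2 hg, h⟩))
  · have h1 : (S.card : ℝ) ≤ (S \ (A ∪ E)).card + (A.card + E.card) := by
      have := Finset.card_le_card_sdiff_add_card (s := S) (t := A ∪ E)
      have h' := Finset.card_union_le A E
      exact_mod_cast (by omega : S.card ≤ (S \ (A ∪ E)).card + (A.card + E.card))
    have h2 : ((S \ (A ∪ E)).card : ℝ) * J ≤ (((S \ (A ∪ E)) ×ˢ cellIndex τ T k) \ C).card + C.card := by
      have := Finset.card_le_card_sdiff_add_card (s := (S \ (A ∪ E)) ×ˢ cellIndex τ T k) (t := C)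
      rw [Finset.card_product] at this
      rw [hJ]
      exact_mod_cast this
    have h3 : P.card * Y * J * (3 / 4) ≤ ((S \ (A ∪ E)).card : ℝ) * J := by
      have h4 : P.card * Y * (3 / 4) ≤ ((S \ (A ∪ E)).card : ℝ) := by linarith
      have hJ0 : 0 ≤ J := by positivity
      nlinarith
    linarith [(by positivity : 0 ≤ P.card * Y * J)]

section hits

variable {m k : ℕ} {τ b : Fin m → ℝ} {T r δ : ℝ} {U : Set (Fin m → ℝ)}

lemma mem_cellsIn {x : ((_ : ℕ) × (Fin m → ℤ)) × (Fin m → ℕ)} :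
    x ∈ cellsIn τ T k b r ↔
      (x.1.1 ∈ dyadicPrimes k ∧ x.1.2 ∈ basePts b r x.1.1) ∧ x.2 ∈ cellIndex τ T k := by
  simp [cellsIn]

/-- Rational points whose cells meet a common set of small diameter are close. -/
lemma div_sub_div_le_of_meet (hU : ∀ y ∈ U, ∀ z ∈ U, ∀ i, y i - z i ≤ δ)
    {x x' : ((_ : ℕ) × (Fin m → ℤ)) × (Fin m → ℕ)} (hx : x ∈ cellsIn τ T k b r)
    (hx' : x' ∈ cellsIn τ T k b r) (h : (closedCell τ T k x ∩ U).Nonempty)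
    (h' : (closedCell τ T k x' ∩ U).Nonempty) (i : Fin m) :
    (x.1.2 i : ℝ) / x.1.1 - (x'.1.2 i : ℝ) / x'.1.1 ≤ δ + cellOffset τ k i := by
  obtain ⟨y, hy, hyU⟩ := h
  obtain ⟨z, hz, hzU⟩ := h'
  have h1 := cell_bounds (mem_cellsIn.1 hx).2 hy i
  have h2 := cell_bounds (mem_cellsIn.1 hx').2 hz i
  linarith [hU y hyU z hzU i, h1.1, h2.2]

lemma card_meet_le_of_large (hτ : ∀ i, 0 < τ i) (hδ : 1 / (4 * 2 ^ k) ≤ δ)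
    (hU : ∀ y ∈ U, ∀ z ∈ U, ∀ i, y i - z i ≤ δ)
    (F : Finset (((_ : ℕ) × (Fin m → ℤ)) × (Fin m → ℕ))) (hF : F ⊆ cellsIn τ T k b r)
    (hmeet : ∀ x ∈ F, (closedCell τ T k x ∩ U).Nonempty) :
    (F.card : ℝ) ≤ (dyadicPrimes k).card * (18 * 2 ^ k * δ) ^ m * (cellIndex τ T k).card := by
  classical
  have hδ0 : 0 < δ := lt_of_lt_of_le (by positivity) hδ
  set D : ℕ → Finset (Fin m → ℤ) := fun q =>
    (basePts b r q).filter fun p => ∃ x ∈ F, x.1 = ⟨q, p⟩ with hD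
  have hsub : F ⊆ ((dyadicPrimes k).sigma D) ×ˢ cellIndex τ T k := fun x hx => by
    have h := mem_cellsIn.1 (hF hx)
    exact Finset.mem_product.2 ⟨Finset.mem_sigma.2 ⟨h.1.1, Finset.mem_filter.2 ⟨h.1.2, x, hx, rfl⟩⟩,
      h.2⟩
  have hDcard : ∀ q ∈ dyadicPrimes k, ((D q).card : ℝ) ≤ (18 * 2 ^ k * δ) ^ m := by
    intro q hq
    have hq0 : (0 : ℝ) < q := by exact_mod_cast (mem_dyadicPrimes.1 hq).2.pos
    have hq2 := lt_of_mem_dyadicPrimes hq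
    have hQδ : 1 ≤ 4 * (2 ^ k * δ) := by
      rw [div_le_iff₀ (by positivity)] at hδ
      linarith
    refine (card_le_prod_of_sub_le (D q) (L := fun _ => 17 * 2 ^ k * δ - 1)
      (fun i => by linarith) fun p hp p' hp' i => ?_).trans ?_
    · obtain ⟨_, x, hx, hxe⟩ := Finset.mem_filter.1 hp
      obtain ⟨_, x', hx', hxe'⟩ := Finset.mem_filter.1 hp'
      have h := div_sub_div_le_of_meet hU (hF hx) (hF hx') (hmeet x hx) (hmeet x' hx') i
      rw [hxe, hxe'] at h
      simp only at h
      rw [← sub_div, div_le_iff₀ hq0] at h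
      have h3 := two_mul_cellOffset_mul_lt (hτ i) hq
      have h4 : δ * q ≤ δ * (2 * 2 ^ k) := by gcongr
      linarith
    · simp only [sub_add_cancel, Finset.prod_const, Finset.card_univ, Fintype.card_fin]
      gcongr
      norm_num
  calc (F.card : ℝ) ≤ ((((dyadicPrimes k).sigma D) ×ˢ cellIndex τ T k).card : ℝ) :=
        Nat.cast_le.2 (Finset.card_le_card hsub)
    _ = (∑ q ∈ dyadicPrimes k, ((D q).card : ℝ)) * (cellIndex τ T k).card := by
        rw [Finset.card_product, Finset.card_sigma]; push_cast; rfl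
    _ ≤ (∑ q ∈ dyadicPrimes k, (18 * 2 ^ k * δ) ^ m) * (cellIndex τ T k).card := by
        gcongr with q hq
        exact hDcard q hq
    _ = _ := by rw [Finset.sum_const, nsmul_eq_mul]

lemma card_cells_meet_le (hT : ∀ i, τ i ≤ T) (hδ : cellSide T k ≤ δ)
    (hU : ∀ y ∈ U, ∀ z ∈ U, ∀ i, y i - z i ≤ δ) (w : (_ : ℕ) × (Fin m → ℤ))
    (F : Finset (Fin m → ℕ)) (hF : F ⊆ cellIndex τ T k)
    (hmeet : ∀ j ∈ F, (closedCell τ T k (w, j) ∩ U).Nonempty) :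
    (F.card : ℝ) ≤ (cellIndex τ T k).card * ∏ i, min 1 (6 * δ / cellOffset τ k i) := by
  classical
  have hs := cellSide_pos T k
  have hδ0 : 0 < δ := hs.trans_le hδ
  rw [card_cellIndex]
  push_cast
  rw [← Finset.prod_mul_distrib]
  refine card_le_prod_of_image F _ fun i => ?_
  have ha := cellOffset_pos τ k i
  have hJ : (0 : ℝ) < cellCount τ T k i := by exact_mod_cast cellCount_pos (hT i)
  rw [mul_min_of_nonneg _ _ hJ.le, mul_one]
  refine le_min ?_ ?_
  · have : F.image (fun p => p i) ⊆ Finset.range (cellCount τ T k i) := fun n hn => by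
      obtain ⟨j, hj, rfl⟩ := Finset.mem_image.1 hn
      exact Finset.mem_range.2 (mem_cellIndex.1 (hF hj) i)
    have := Finset.card_le_card this
    rw [Finset.card_range] at this
    exact_mod_cast this
  · have h1 : (((F.image fun p => p i).image ((↑) : ℕ → ℤ)).card : ℝ) ≤ (δ / cellSide T k + 1) + 1 := by
      refine card_le_of_sub_le _ (by positivity) fun u hu v hv => ?_
      simp only [Finset.mem_image, exists_exists_and_eq_and] at hu hv
      obtain ⟨j, hj, rfl⟩ := hu
      obtain ⟨j', hj', rfl⟩ := hv
      obtain ⟨y, hy, hyU⟩ := hmeet j hj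
      obtain ⟨z, hz, hzU⟩ := hmeet j' hj'
      have h1 := hy i (mem_univ i)
      have h2 := hz i (mem_univ i)
      have h3 := hU y hyU z hzU i
      simp only [cellCorner] at h1 h2
      push_cast
      rw [div_add_one hs.ne', le_div_iff₀ hs]
      linarith [h1.1, h2.2]
    rw [Finset.card_image_of_injective _ Nat.cast_injective] at h1
    refine h1.trans ?_
    have h2 : cellCount τ T k i * (6 * δ / cellOffset τ k i) ≥ 3 * (δ / cellSide T k) := by
      have := cellOffset_le_two_mul (k := k) (hT i)
      rw [ge_iff_le, mul_div_assoc', mul_div_assoc', div_le_div_iff₀ hs ha]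
      nlinarith
    have h3 : 1 ≤ δ / cellSide T k := by rwa [one_le_div hs]
    linarith

lemma card_meet_le_of_small (hτ : ∀ i, 0 < τ i) (hT : ∀ i, τ i ≤ T) (hδ : cellSide T k ≤ δ)
    (hδ' : δ < 1 / (4 * 2 ^ k)) {g : ℕ} (hg : δ ≤ (1 / 2) ^ g / 2 ^ k) {X : ℝ} (hX : 0 ≤ X)
    (hU : ∀ y ∈ U, ∀ z ∈ U, ∀ i, y i - z i ≤ δ)
    (F : Finset (((_ : ℕ) × (Fin m → ℤ)) × (Fin m → ℕ))) (hF : F ⊆ cellsIn τ T k b r)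
    (hclose : ∀ x ∈ F,
      ((closePts (dyadicPrimes k) (closeRadius τ k g) x.1.1 x.1.2).card : ℝ) ≤ X)
    (hmeet : ∀ x ∈ F, (closedCell τ T k x ∩ U).Nonempty) :
    (F.card : ℝ) ≤
      (1 + X) * ((cellIndex τ T k).card * ∏ i, min 1 (6 * δ / cellOffset τ k i)) := by
  classical
  have hs := cellSide_pos T k
  have hδ0 : 0 < δ := hs.trans_le hδ
  have hM : 0 ≤ ∏ i, min 1 (6 * δ / cellOffset τ k i) := Finset.prod_nonneg fun i _ => by
    have := cellOffset_pos τ k i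
    positivity
  rcases F.eq_empty_or_nonempty with rfl | ⟨x₀, hx₀⟩
  · simp only [Finset.card_empty, Nat.cast_zero]; positivity
  have h1 : ((F.image Prod.fst).card : ℝ) ≤ 1 + X := by
    have hsub : F.image Prod.fst ⊆
        insert x₀.1 (closePts (dyadicPrimes k) (closeRadius τ k g) x₀.1.1 x₀.1.2) := by
      intro w hw
      obtain ⟨x, hx, rfl⟩ := Finset.mem_image.1 hw
      have hxc := mem_cellsIn.1 (hF hx)
      have hxc₀ := mem_cellsIn.1 (hF hx₀)
      have hd : ∀ i, |(x₀.1.2 i : ℝ) / x₀.1.1 - (x.1.2 i : ℝ) / x.1.1| ≤ δ + cellOffset τ k i := by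
        intro i
        have e1 := div_sub_div_le_of_meet hU (hF hx) (hF hx₀) (hmeet x hx) (hmeet x₀ hx₀) i
        have e2 := div_sub_div_le_of_meet hU (hF hx₀) (hF hx) (hmeet x₀ hx₀) (hmeet x hx) i
        rw [abs_le]
        constructor <;> linarith
      rw [Finset.mem_insert]
      by_cases hq : x.1.1 = x₀.1.1
      · left
        obtain ⟨⟨q, p⟩, j⟩ := x
        obtain ⟨⟨q₀, p₀⟩, j₀⟩ := x₀
        simp only at hq hd hxc hxc₀ ⊢
        subst hq
        have hq0 : (0 : ℝ) < q := by exact_mod_cast (mem_dyadicPrimes.1 hxc.1.1).2.pos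
        congr 1
        funext i
        have h3 := hd i
        rw [← sub_div, abs_div, abs_of_pos hq0, div_le_iff₀ hq0] at h3
        have h4 := cellOffset_le (k := k) (hτ i)
        have h5 := lt_of_mem_dyadicPrimes hxc.1.1
        have h6 : (δ + cellOffset τ k i) * q < 1 := by
          have ha := cellOffset_pos τ k i
          calc _ ≤ (δ + cellOffset τ k i) * (2 * 2 ^ k : ℝ) := by gcongr
            _ < (1 / (4 * 2 ^ k) + 1 / (4 * 2 ^ k)) * (2 * 2 ^ k : ℝ) :=
                mul_lt_mul_of_pos_right (add_lt_add_of_lt_of_le hδ' h4) (by positivity)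
            _ = 1 := by field_simp; norm_num
        have h7 : |p₀ i - p i| < 1 := by exact_mod_cast h3.trans_lt h6
        have := Int.abs_lt_one_iff.1 h7
        omega
      · right
        refine Finset.mem_sigma.2 ⟨Finset.mem_erase.2 ⟨hq, hxc.1.1⟩, Finset.mem_filter.2
          ⟨(Finset.mem_filter.1 hxc.1.2).1, fun i => (hd i).trans_lt ?_⟩⟩
        have := cellOffset_pos τ k i
        unfold closeRadius
        linarith
    have h2 := (Finset.card_le_card hsub).trans (Finset.card_insert_le _ _)
    have h3 := hclose x₀ hx₀
    have h4 : ((F.image Prod.fst).card : ℝ) ≤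
        ((closePts (dyadicPrimes k) (closeRadius τ k g) x₀.1.1 x₀.1.2).card : ℝ) + 1 := by
      exact_mod_cast h2
    linarith
  have h2 : F.card = ∑ w ∈ F.image Prod.fst, (F.filter fun x => x.1 = w).card :=
    Finset.card_eq_sum_card_image _ _
  rw [h2]
  push_cast
  calc _ ≤ ∑ w ∈ F.image Prod.fst,
        ((cellIndex τ T k).card * ∏ i, min 1 (6 * δ / cellOffset τ k i) : ℝ) := by
        refine Finset.sum_le_sum fun w _ => ?_
        have e : ((F.filter fun x => x.1 = w).image Prod.snd).card =
            (F.filter fun x => x.1 = w).card := by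
          refine Finset.card_image_of_injOn fun x hx y hy hxy => ?_
          exact Prod.ext ((Finset.mem_filter.1 hx).2.trans (Finset.mem_filter.1 hy).2.symm) hxy
        rw [← e]
        refine card_cells_meet_le hT hδ hU w _ ?_ ?_
        · intro j hj
          obtain ⟨x, hx, rfl⟩ := Finset.mem_image.1 hj
          exact (mem_cellsIn.1 (hF (Finset.mem_filter.1 hx).1)).2
        · intro j hj
          obtain ⟨x, hx, rfl⟩ := Finset.mem_image.1 hj
          obtain ⟨hx1, rfl⟩ := Finset.mem_filter.1 hx
          exact hmeet x hx1
    _ = (F.image Prod.fst).card *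
        ((cellIndex τ T k).card * ∏ i, min 1 (6 * δ / cellOffset τ k i) : ℝ) := by
        rw [Finset.sum_const, nsmul_eq_mul]
    _ ≤ _ := by gcongr

end hits

lemma prod_min_le_of_scale {m k : ℕ} {τ : Fin m → ℝ} {T s₁ δ : ℝ} (hτ : ∀ i, 0 < τ i)
    (hT : ∀ i, τ i ≤ T) (hk : 1 ≤ k) (hδ : 0 < δ) (hδ' : δ ≤ 1 / 2 ^ k)
    (hs₁ : ∀ t : ℝ, 0 ≤ t → s₁ * (1 + t) ≤ m + 1 + ∑ i, max 0 (t - τ i)) :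
    ∏ i, min 1 (6 * δ / cellOffset τ k i) ≤
      (12 * 2 ^ (1 + T)) ^ m * ((2 ^ k) ^ (m + 1) * δ ^ s₁) := by
  have hQ : (1 : ℝ) < 2 ^ k := one_lt_pow₀ (by norm_num) (by omega)
  have hQ0 : (0 : ℝ) < 2 ^ k := by positivity
  have h1 := rpow_mul_prod_min_le hQ hδ hδ' hs₁
  have hC1 : ∀ i, (12 : ℝ) * 2 ^ (1 + τ i) ≤ 12 * 2 ^ (1 + T) := fun i => by
    gcongr
    · norm_num
    · exact hT i
  have hC : ∀ i, (1 : ℝ) ≤ 12 * 2 ^ (1 + T) := fun i => by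
    have : (1 : ℝ) ≤ 2 ^ (1 + T) :=
      Real.one_le_rpow (by norm_num) (by linarith [hτ i, hT i])
    linarith
  calc ∏ i, min 1 (6 * δ / cellOffset τ k i)
      ≤ ∏ i : Fin m, (12 * 2 ^ (1 + T)) * min 1 (δ * (2 ^ k) ^ (1 + τ i)) := by
        refine Finset.prod_le_prod (fun i _ => ?_) fun i _ => ?_
        · have := cellOffset_pos τ k i
          positivity
        · rw [mul_min_of_nonneg _ _ (by linarith [hC i])]
          refine min_le_min (by linarith [hC i]) ?_
          have e : 6 * δ / cellOffset τ k i = 12 * 2 ^ (1 + τ i) * (δ * (2 ^ k) ^ (1 + τ i)) := by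
            rw [cellOffset, Real.rpow_neg (by positivity), Real.mul_rpow (by norm_num) hQ0.le]
            field_simp
            norm_num
          rw [e]
          exact mul_le_mul_of_nonneg_right (hC1 i) (by positivity)
    _ = (12 * 2 ^ (1 + T)) ^ m * ∏ i, min 1 (δ * (2 ^ k) ^ (1 + τ i)) := by
        rw [Finset.prod_mul_distrib]; simp
    _ ≤ _ := by
        gcongr
        rw [Real.rpow_neg hQ0.le, inv_mul_le_iff₀ (by positivity)] at h1
        exact_mod_cast h1

lemma closeBound_mul_prod_le {m k G g : ℕ} {τ : Fin m → ℝ} {r δ : ℝ} (hr : 0 < r) (hδ : 0 < δ)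
    (hg' : (1 / 2) ^ g / 2 ^ k ≤ 2 * δ) :
    closeBound τ k G r g * ∏ i, min 1 (6 * δ / cellOffset τ k i) ≤
      (dyadicPrimes k).card * (2 ^ k * r / 2) ^ m * (8 * G * (896 / r ^ 2) ^ m * δ ^ m) := by
  have hp : (∏ i, closeRadius τ k g i) * ∏ i, min 1 (6 * δ / cellOffset τ k i) ≤ (28 * δ) ^ m := by
    rw [← Finset.prod_mul_distrib]
    calc _ ≤ ∏ i : Fin m, 28 * δ := by
          refine Finset.prod_le_prod (fun i _ => ?_) fun i _ => ?_
          · have h1 := cellOffset_pos τ k i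
            have h2 := closeRadius_pos τ k g i
            positivity
          · have h1 := cellOffset_pos τ k i
            have h2 : closeRadius τ k g i ≤ 4 * δ + 4 * cellOffset τ k i := by
              unfold closeRadius; linarith
            have h3 : 4 * δ * min 1 (6 * δ / cellOffset τ k i) ≤ 4 * δ * 1 := by
              gcongr; exact min_le_left _ _
            have h4 : 4 * cellOffset τ k i * min 1 (6 * δ / cellOffset τ k i) ≤
                4 * cellOffset τ k i * (6 * δ / cellOffset τ k i) := by
              gcongr; exact min_le_right _ _
            have h5 : 4 * cellOffset τ k i * (6 * δ / cellOffset τ k i) = 24 * δ := by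
              field_simp; norm_num
            have h6 : 0 ≤ min 1 (6 * δ / cellOffset τ k i) := by positivity
            nlinarith
      _ = _ := by simp
  have hY : (0 : ℝ) < (2 ^ k * r / 2) ^ m := by positivity
  rw [closeBound, div_mul_eq_mul_div, div_le_iff₀ hY, mul_assoc]
  calc _ ≤ 8 * G * (dyadicPrimes k).card * (8 * (2 ^ k) ^ 2) ^ m * (28 * δ) ^ m := by gcongr
    _ = _ := by
      have : (8 * (2 ^ k) ^ 2 : ℝ) ^ m * 28 ^ m =
          (2 ^ k * r / 2) ^ m * (2 ^ k * r / 2) ^ m * (896 / r ^ 2) ^ m := by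
        rw [← mul_pow, ← mul_pow, ← mul_pow]
        congr 1
        field_simp
        norm_num
      rw [mul_pow 28]
      linear_combination (8 * G * ((dyadicPrimes k).card : ℝ) * δ ^ m) * this

lemma one_add_closeBound_mul_prod_le {m k A g : ℕ} {τ : Fin m → ℝ} {T s₁ r δ : ℝ}
    (hτ : ∀ i, 0 < τ i) (hT : ∀ i, τ i ≤ T) (hr : 0 < r) (hk : 1 ≤ k)
    (hP : (2 : ℝ) ^ k ≤ (k : ℝ) ^ 2 * (dyadicPrimes k).card) (hδ : 0 < δ) (hδ' : δ ≤ 1 / 2 ^ k)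
    (hg' : (1 / 2) ^ g / 2 ^ k ≤ 2 * δ)
    (hs₁ : ∀ t : ℝ, 0 ≤ t → s₁ * (1 + t) ≤ m + 1 + ∑ i, max 0 (t - τ i)) :
    (1 + closeBound τ k (A * k) r g) * ∏ i, min 1 (6 * δ / cellOffset τ k i) ≤
      (dyadicPrimes k).card * (2 ^ k * r / 2) ^ m *
        ((24 * 2 ^ (1 + T) / r) ^ m * k ^ 2 * δ ^ s₁ +
          8 * A * (896 / r ^ 2) ^ m * k * δ ^ (m : ℝ)) := by
  have h1 := prod_min_le_of_scale hτ hT hk hδ hδ' hs₁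
  have h2 := closeBound_mul_prod_le (G := A * k) (τ := τ) hr hδ hg'
  rw [one_add_mul, mul_add]
  refine add_le_add (h1.trans ?_) (h2.trans (le_of_eq ?_))
  · have e : (24 * 2 ^ (1 + T) / r : ℝ) ^ m * (2 ^ k * r / 2) ^ m =
        (12 * 2 ^ (1 + T)) ^ m * (2 ^ k) ^ m := by
      rw [← mul_pow, ← mul_pow]
      congr 1
      field_simp
      norm_num
    calc (12 * 2 ^ (1 + T)) ^ m * ((2 ^ k) ^ (m + 1) * δ ^ s₁)
        = (12 * 2 ^ (1 + T)) ^ m * (2 ^ k) ^ m * δ ^ s₁ * 2 ^ k := by ring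
      _ ≤ (12 * 2 ^ (1 + T)) ^ m * (2 ^ k) ^ m * δ ^ s₁ * ((k : ℝ) ^ 2 * (dyadicPrimes k).card) := by
          gcongr
      _ = _ := by rw [← e]; ring
  · push_cast
    rw [Real.rpow_natCast]
    ring

/-- Selecting a member of a finite family which is only met by a light part of a cover. -/
lemma exists_light_member {X α : Type*} (F : Finset α) (hF : F.Nonempty) (C : α → Set X) (D : Set X)
    (hCD : ∀ x ∈ F, C x ⊆ D) (U : ℕ → Set X) (δ : ℕ → ℝ) (hδ : ∀ n, 0 < δ n) {s r r' K ε : ℝ}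
    (hs : 0 < s) (hr : 0 < r) (hr' : 0 < r') (hK : 1 ≤ K) (hε : ε = 1 / (2 * K))
    (hsum : ∑' n, {n | (D ∩ U n).Nonempty}.indicator (fun n => ENNReal.ofReal (δ n ^ s)) n ≤
      ENNReal.ofReal (ε * r ^ s))
    (hsmall : ∀ n, δ n ≤ r' → ∀ H ⊆ F, (∀ x ∈ H, (C x ∩ U n).Nonempty) →
      (H.card : ℝ) ≤ 1 / 4 * (r' / r) ^ s * F.card)
    (hlarge : ∀ n, r' < δ n → δ n ≤ r → ∀ H ⊆ F, (∀ x ∈ H, (C x ∩ U n).Nonempty) →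
      (H.card : ℝ) ≤ K * (δ n / r) ^ s * F.card) :
    ∃ x ∈ F, ∑' n, {n | (C x ∩ U n).Nonempty}.indicator (fun n => ENNReal.ofReal (δ n ^ s)) n ≤
      ENNReal.ofReal (ε * r' ^ s) := by
  classical
  have hε0 : 0 < ε := by rw [hε]; positivity
  have hε1 : ε ≤ 1 := by
    rw [hε, div_le_one (by positivity)]; linarith
  set f : ℕ → ℝ := fun n => if δ n ≤ r' then (δ n / r') ^ s / ε else 1 with hf
  have hf0 : ∀ n, 0 ≤ f n := fun n => by
    have := hδ n
    simp only [hf]; split_ifs <;> positivity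
  have hterm : ∀ n, ∑ x ∈ F, {n | (C x ∩ U n).Nonempty}.indicator (fun n => ENNReal.ofReal (f n)) n ≤
      {n | (D ∩ U n).Nonempty}.indicator (fun n => ENNReal.ofReal (δ n ^ s)) n *
        ENNReal.ofReal (F.card / (2 * (ε * r ^ s))) := by
    intro n
    have e : ∑ x ∈ F, {n | (C x ∩ U n).Nonempty}.indicator (fun n => ENNReal.ofReal (f n)) n =
        ENNReal.ofReal ((F.filter fun x => (C x ∩ U n).Nonempty).card * f n) := by
      simp only [Set.indicator_apply, mem_ofPred_eq]
      rw [← Finset.sum_filter, Finset.sum_const, nsmul_eq_mul, ENNReal.ofReal_mul (by positivity),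
        ENNReal.ofReal_natCast]
    rw [e]
    by_cases hD : (D ∩ U n).Nonempty
    · rw [Set.indicator_of_mem (by exact hD), ← ENNReal.ofReal_mul (by have := hδ n; positivity)]
      refine ENNReal.ofReal_le_ofReal ?_
      have hδn := hδ n
      have hle : δ n ≤ r := by
        have h1 := (ENNReal.le_tsum n).trans hsum
        rw [Set.indicator_of_mem (by exact hD), ENNReal.ofReal_le_ofReal_iff (by positivity)] at h1
        have h2 : δ n ^ s ≤ r ^ s := h1.trans (by
          have : 0 < r ^ s := by positivity
          nlinarith)
        exact (Real.rpow_le_rpow_iff hδn.le hr.le hs).1 h2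
      by_cases hc : δ n ≤ r'
      · have h1 := hsmall n hc _ (Finset.filter_subset _ _) fun x hx => (Finset.mem_filter.1 hx).2
        simp only [hf, if_pos hc]
        calc _ ≤ 1 / 4 * (r' / r) ^ s * F.card * ((δ n / r') ^ s / ε) := by gcongr
          _ = 1 / 2 * (δ n ^ s * (F.card / (2 * (ε * r ^ s)))) := by
            rw [Real.div_rpow hr'.le hr.le, Real.div_rpow hδn.le hr'.le]
            field_simp
            norm_num
          _ ≤ _ := by
            have : 0 ≤ δ n ^ s * (F.card / (2 * (ε * r ^ s))) := by positivity
            linarith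
      · have h1 := hlarge n (not_le.1 hc) hle _ (Finset.filter_subset _ _)
          fun x hx => (Finset.mem_filter.1 hx).2
        simp only [hf, if_neg hc, mul_one]
        refine h1.trans (le_of_eq ?_)
        rw [Real.div_rpow hδn.le hr.le, hε]
        field_simp
    · have : F.filter (fun x => (C x ∩ U n).Nonempty) = ∅ :=
        Finset.filter_eq_empty_iff.2 fun x hx h => hD (h.mono (inter_subset_inter_left _ (hCD x hx)))
      rw [this]
      simp
  have htot : ∑ x ∈ F, ∑' n, {n | (C x ∩ U n).Nonempty}.indicator (fun n => ENNReal.ofReal (f n)) n ≤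
      ENNReal.ofReal (F.card / 2) := by
    rw [← Summable.tsum_finsetSum fun _ _ => ENNReal.summable]
    refine (ENNReal.tsum_le_tsum hterm).trans ?_
    rw [ENNReal.tsum_mul_right]
    refine (mul_le_mul_left hsum _).trans ?_
    rw [← ENNReal.ofReal_mul (by positivity)]
    refine ENNReal.ofReal_le_ofReal (le_of_eq ?_)
    field_simp
  have hcard : (0 : ℝ) < F.card := by exact_mod_cast hF.card_pos
  obtain ⟨x, hx, hlt⟩ : ∃ x ∈ F,
      ∑' n, {n | (C x ∩ U n).Nonempty}.indicator (fun n => ENNReal.ofReal (f n)) n < 1 := by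
    by_contra! hcon
    have h1 : (F.card : ENNReal) ≤ ENNReal.ofReal (F.card / 2) := by
      refine le_trans ?_ htot
      calc (F.card : ENNReal) = ∑ x ∈ F, 1 := by simp
        _ ≤ _ := Finset.sum_le_sum hcon
    rw [← ENNReal.ofReal_natCast, ENNReal.ofReal_le_ofReal_iff (by positivity)] at h1
    linarith
  refine ⟨x, hx, ?_⟩
  have hle : ∀ n, {n | (C x ∩ U n).Nonempty}.indicator (fun n => ENNReal.ofReal (δ n ^ s)) n ≤
      {n | (C x ∩ U n).Nonempty}.indicator (fun n => ENNReal.ofReal (f n)) n *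
        ENNReal.ofReal (ε * r' ^ s) := by
    intro n
    by_cases hm : (C x ∩ U n).Nonempty
    · have h1 := (ENNReal.le_tsum n).trans_lt hlt
      rw [Set.indicator_of_mem (by exact hm)] at h1 ⊢
      rw [Set.indicator_of_mem (by exact hm), ← ENNReal.ofReal_mul (hf0 n)]
      have hc : δ n ≤ r' := by
        by_contra hc
        simp [hf, hc] at h1
      refine ENNReal.ofReal_le_ofReal (le_of_eq ?_)
      simp only [hf, if_pos hc]
      rw [Real.div_rpow (hδ n).le hr'.le]
      field_simp
    · rw [Set.indicator_of_notMem (by exact hm)]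
      exact zero_le
  refine (ENNReal.tsum_le_tsum hle).trans ?_
  rw [ENNReal.tsum_mul_right]
  exact (mul_le_mul_left hlt.le _).trans (by rw [one_mul])

lemma exists_dyadic_scale {k A : ℕ} {T δ : ℝ} (hA : 2 * T + 3 ≤ A) (hk : 1 ≤ k)
    (hδ : cellSide T k ≤ δ) (hδ' : δ < 1 / (4 * 2 ^ k)) :
    ∃ g < A * k, δ ≤ (1 / 2) ^ g / 2 ^ k ∧ (1 / 2 : ℝ) ^ g / 2 ^ k ≤ 2 * δ := by
  have hQ : (0 : ℝ) < 2 ^ k := by positivity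
  have hδ0 := (cellSide_pos T k).trans_le hδ
  have h1 : δ * 2 ^ k ≤ 1 := by
    rw [lt_div_iff₀ (by positivity)] at hδ'
    nlinarith
  obtain ⟨g, hg1, hg2⟩ := exists_nat_pow_near_of_lt_one (mul_pos hδ0 hQ) h1
    (by norm_num : (0 : ℝ) < 1 / 2) (by norm_num)
  refine ⟨g, ?_, by rwa [le_div_iff₀ hQ], ?_⟩
  · have h2 : (1 / 2 : ℝ) ^ (A * k) < (1 / 2) ^ g := by
      refine lt_of_lt_of_le ?_ hg2
      refine lt_of_lt_of_le ?_ (mul_le_mul_of_nonneg_right hδ hQ.le)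
      have hk' : (1 : ℝ) ≤ k := by exact_mod_cast hk
      have e1 : cellSide T k * 2 ^ k = (2 : ℝ) ^ (-(k * T + T + 2)) := by
        have e : (2 * 2 ^ k : ℝ) = 2 ^ ((k : ℝ) + 1) := by
          rw [Real.rpow_add_one (by norm_num), Real.rpow_natCast]; ring
        rw [cellSide, e, ← Real.rpow_mul (by norm_num), ← Real.rpow_sub_one (by norm_num),
          ← Real.rpow_natCast, ← Real.rpow_add (by norm_num)]
        congr 1
        ring
      have e2 : (1 / 2 : ℝ) ^ (A * k) = (2 : ℝ) ^ (-((A : ℝ) * k)) := by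
        rw [Real.rpow_neg (by norm_num), one_div, inv_pow, ← Nat.cast_mul, Real.rpow_natCast]
      rw [e1, e2]
      refine Real.rpow_lt_rpow_of_exponent_lt (by norm_num) (neg_lt_neg ?_)
      have : (2 * T + 3) * k ≤ A * k := by gcongr
      nlinarith
    exact (pow_lt_pow_iff_right_of_lt_one₀ (by norm_num) (by norm_num)).1 h2
  · rw [div_le_iff₀ hQ]
    rw [pow_succ] at hg1
    linarith

lemma le_of_closedCube_subset {m : ℕ} {b b' : Fin m → ℝ} {r r' : ℝ} (hr' : 0 ≤ r')
    (h : closedCube b' r' ⊆ closedCube b r) (i : Fin m) : b i ≤ b' i ∧ b' i + r' ≤ b i + r := by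
  have h1 : b' ∈ closedCube b' r' := fun i _ => ⟨le_rfl, by linarith⟩
  have h2 : (fun i => b' i + r') ∈ closedCube b' r' := fun i _ => ⟨by linarith, le_rfl⟩
  exact ⟨(h h1 i (mem_univ i)).1, (h h2 i (mem_univ i)).2⟩

lemma closedCell_subset {m k : ℕ} {τ b : Fin m → ℝ} {T r : ℝ} (hτ : ∀ i, 0 < τ i)
    {x : ((_ : ℕ) × (Fin m → ℤ)) × (Fin m → ℕ)} (hx : x ∈ cellsIn τ T k b r) :
    closedCell τ T k x ⊆ closedCube b r := by
  intro y hy i _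
  have hx' := mem_cellsIn.1 hx
  have hq0 : (0 : ℝ) < x.1.1 := by exact_mod_cast (mem_dyadicPrimes.1 hx'.1.1).2.pos
  have h1 := cell_bounds hx'.2 hy i
  have h2 := (Finset.mem_filter.1 hx'.1.2).2 i
  have h3 := two_mul_cellOffset_mul_lt (hτ i) hx'.1.1
  have h4 := cellOffset_pos τ k i
  have h5 : 2 * cellOffset τ k i < 1 / x.1.1 := by
    rw [lt_div_iff₀ hq0]; linarith
  rw [add_div] at h2
  constructor <;> linarith

/-- The cubes used in the construction: contained in the unit cube, met only by a light part of the
cover `U`, and mostly free of points close to rationals with denominators larger than `N`. -/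
structure Admissible {m : ℕ} (τ : Fin m → ℝ) (c s ε : ℝ) (U : ℕ → Set (Fin m → ℝ)) (δ : ℕ → ℝ)
    (b : Fin m → ℝ) (r : ℝ) (N : ℕ) : Prop where
  pos : 0 < r
  nonneg : ∀ i, 0 ≤ b i
  le_one : ∀ i, b i + r ≤ 1
  light : ∑' n, {n | (closedCube b r ∩ U n).Nonempty}.indicator
    (fun n => ENNReal.ofReal (δ n ^ s)) n ≤ ENNReal.ofReal (ε * r ^ s)
  sparse : volume (icoCube b r ∩ nearTail (2 * c) τ N) ≤ ENNReal.ofReal ((1 / 4) ^ m / 8 * r ^ m)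

lemma exists_scale {m N' : ℕ} {τ : Fin m → ℝ} {c r s s₁ C₁ C₂ θ : ℝ} (N : ℕ) (hc : 0 < c)
    (hr : 0 < r) (hs₁ : s < s₁) (hsm : s < m) (hθ : 0 < θ) (hC₁ : 0 ≤ C₁) (hC₂ : 0 ≤ C₂) :
    ∃ k : ℕ, 1 ≤ k ∧ (2 : ℝ) ^ k ≤ (k : ℝ) ^ 2 * (dyadicPrimes k).card ∧ 6 ≤ 2 ^ k * r ∧
      (N : ℝ) < 2 ^ k ∧
      (∀ n : ℕ, 0 < n → n ≤ N' → ∀ i, (n : ℝ) / 2 ^ k ≤ c * (n : ℝ) ^ (-τ i)) ∧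
      ∀ δ, 0 < δ → δ ≤ 1 / 2 ^ k → C₁ * (k : ℝ) ^ 2 * δ ^ s₁ + C₂ * k * δ ^ (m : ℝ) ≤ θ * δ ^ s := by
  have hpow : Filter.Tendsto (fun k : ℕ => (2 : ℝ) ^ k) Filter.atTop Filter.atTop :=
    tendsto_pow_atTop_atTop_of_one_lt (by norm_num)
  have h1 := hpow.eventually_ge_atTop (6 / r)
  have h2 := hpow.eventually_gt_atTop (N : ℝ)
  have h3 : ∀ᶠ k : ℕ in Filter.atTop, ∀ n ∈ Finset.Icc 1 N', ∀ i,
      (n : ℝ) / 2 ^ k ≤ c * (n : ℝ) ^ (-τ i) := by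
    rw [Filter.eventually_all_finset]
    intro n hn
    rw [Filter.eventually_all]
    intro i
    have hn0 : (0 : ℝ) < n := by exact_mod_cast (Finset.mem_Icc.1 hn).1
    have : Filter.Tendsto (fun k : ℕ => (n : ℝ) / 2 ^ k) Filter.atTop (nhds 0) :=
      hpow.const_div_atTop _
    exact this.eventually_le_const (by positivity)
  have h4 := eventually_scale_absorb hs₁ hsm hθ hC₁ hC₂
  obtain ⟨K, hK⟩ := Filter.eventually_atTop.1
    (h1.and (h2.and (h3.and (h4.and (Filter.eventually_ge_atTop 1)))))
  obtain ⟨k, hk, hkP⟩ := exists_dyadicPrimes_card_ge K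
  obtain ⟨a1, a2, a3, a4, a5⟩ := hK k hk
  refine ⟨k, a5, hkP, ?_, a2, fun n hn hn' => a3 n (Finset.mem_Icc.2 ⟨hn, hn'⟩), a4⟩
  rwa [div_le_iff₀ hr] at a1

lemma Admissible.exists_next {m : ℕ} {τ b : Fin m → ℝ} {T c s s₁ ε r : ℝ}
    {U : ℕ → Set (Fin m → ℝ)} {δ : ℕ → ℝ} {N : ℕ} (h : Admissible τ c s ε U δ b r N)
    (hτ : ∀ i, 0 < τ i) (hT : ∀ i, τ i ≤ T) (hT0 : 0 < T) (hσ : 1 < ∑ i, τ i) (hc : 0 < c)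
    (hcT : 2 * c ≤ 2 ^ (-(2 + T))) (hs : 0 < s) (hss₁ : s < s₁) (hsm : s < m)
    (hs₁ : ∀ t : ℝ, 0 ≤ t → s₁ * (1 + t) ≤ m + 1 + ∑ i, max 0 (t - τ i))
    (hε : ε = 1 / (2 * (2 * 36 ^ m))) (hδ : ∀ n, 0 < δ n)
    (hU : ∀ n, ∀ y ∈ U n, ∀ z ∈ U n, ∀ i, y i - z i ≤ δ n) :
    ∃ b' r' N' q, Admissible τ c s ε U δ b' r' N' ∧ closedCube b' r' ⊆ closedCube b r ∧
      r' ≤ r / 2 ∧ N < N' ∧ N < q ∧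
      (∀ x ∈ closedCube b' r', ∃ p : Fin m → ℤ, ∀ i, |(q : ℝ) * x i - p i| < (q : ℝ) ^ (-τ i)) ∧
      ∀ n, N < n → n ≤ N' → Disjoint (closedCube b' r') (nearRat c τ n) := by
  obtain ⟨hr, hb, hb1, hlight, hsparse⟩ := h
  set η : ℝ := (1 / 4) ^ m / 8 with hη
  set t : ℝ := η / 8 * (r / 2) ^ m / (80 * c) ^ m with ht
  have ht0 : 0 < t := by positivity
  obtain ⟨N', hN', htail⟩ : ∃ N', N < N' ∧ zetaTail (∑ i, τ i) N' ≤ ENNReal.ofReal t :=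
    ((Filter.eventually_gt_atTop N).and ((tendsto_zetaTail hσ).eventually_le_const
      (ENNReal.ofReal_pos.2 ht0))).exists
  obtain ⟨A, hA⟩ := exists_nat_ge (2 * T + 3)
  obtain ⟨k, hk, hkP, hkr, hkN, hkN', habs⟩ := exists_scale (τ := τ) (N' := N')
    (C₁ := (24 * 2 ^ (1 + T) / r) ^ m) (C₂ := 8 * A * (896 / r ^ 2) ^ m) (θ := 1 / 8 / r ^ s)
    N hc hr hss₁ hsm (by positivity) (by positivity) (by positivity)
  have hQ : (0 : ℝ) < 2 ^ k := by positivity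
  have hP : 0 < (dyadicPrimes k).card := by
    rcases Nat.eq_zero_or_pos (dyadicPrimes k).card with h0 | h0
    · rw [h0] at hkP; norm_num at hkP; linarith
    · exact h0
  obtain ⟨F, hF, hF1, hF2, hF3, hF4⟩ := exists_good_cells (G := A * k) hτ hT hc hcT hr hb hb1 hη
    hsparse hP hkr hkN' ht0.le htail (by rw [ht]; field_simp; rfl)
  set r' := cellSide T k with hr'
  have hr'0 : 0 < r' := cellSide_pos T k
  have hr'1 : r' < 1 / (4 * 2 ^ k) := cellSide_lt hT0
  have hJ : (0 : ℝ) < (cellIndex τ T k).card := by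
    rw [card_cellIndex]
    push_cast
    exact Finset.prod_pos fun i _ => by exact_mod_cast cellCount_pos (hT i)
  have hP' : (0 : ℝ) < (dyadicPrimes k).card := by exact_mod_cast hP
  have hFne : F.Nonempty := by
    rw [← Finset.card_pos]
    have : (0 : ℝ) < 2 * F.card := lt_of_lt_of_le (by positivity) hF4
    exact_mod_cast (by linarith : (0 : ℝ) < F.card)
  have hmid : ∀ (V : Set (Fin m → ℝ)) (d : ℝ), r' ≤ d → d < 1 / (4 * 2 ^ k) →
      (∀ y ∈ V, ∀ z ∈ V, ∀ i, y i - z i ≤ d) → ∀ H ⊆ F,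
      (∀ x ∈ H, (closedCell τ T k x ∩ V).Nonempty) →
      (H.card : ℝ) ≤ 1 / 4 * (d / r) ^ s * F.card := by
    intro V d hd hd' hV H hH hmeet
    have hd0 : 0 < d := hr'0.trans_le hd
    have hd1 : d ≤ 1 / 2 ^ k := by
      refine hd'.le.trans ?_
      gcongr
      linarith
    obtain ⟨g, hgA, hg1, hg2⟩ := exists_dyadic_scale hA hk hd hd'
    have hX : 0 ≤ closeBound τ k (A * k) r g := by
      have : 0 < ∏ i, closeRadius τ k g i := Finset.prod_pos fun i _ => closeRadius_pos τ k g i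
      unfold closeBound
      positivity
    have h1 := card_meet_le_of_small hτ hT hd hd' hg1 hX hV H (hH.trans hF)
      (fun x hx => hF3 x (hH hx) g hgA) hmeet
    have h2 := one_add_closeBound_mul_prod_le hτ hT hr hk hkP hd0 hd1 hg2 hs₁ (A := A)
    have h3 := habs d hd0 hd1
    calc (H.card : ℝ) ≤ _ := h1
      _ = (cellIndex τ T k).card * ((1 + closeBound τ k (A * k) r g) *
            ∏ i, min 1 (6 * d / cellOffset τ k i)) := by ring
      _ ≤ (cellIndex τ T k).card * ((dyadicPrimes k).card * (2 ^ k * r / 2) ^ m *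
            (1 / 8 / r ^ s * d ^ s)) := by
          refine mul_le_mul_of_nonneg_left (h2.trans ?_) hJ.le
          refine mul_le_mul_of_nonneg_left ?_ (by positivity)
          exact h3
      _ = (dyadicPrimes k).card * (2 ^ k * r / 2) ^ m * (cellIndex τ T k).card *
            (1 / 8 * (d / r) ^ s) := by
          rw [Real.div_rpow hd0.le hr.le]; ring
      _ ≤ 2 * F.card * (1 / 8 * (d / r) ^ s) := by gcongr
      _ = _ := by ring
  have h36 : (1 : ℝ) ≤ 36 ^ m := one_le_pow₀ (by norm_num)
  obtain ⟨x, hx, hxlight⟩ := exists_light_member F hFne (closedCell τ T k) (closedCube b r)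
    (fun x hx => closedCell_subset hτ (hF hx)) U δ hδ hs hr hr'0 (by linarith) hε hlight
    (fun n hn H hH hm => hmid (U n) r' le_rfl hr'1
      (fun y hy z hz i => (hU n y hy z hz i).trans hn) H hH hm)
    (fun n hn hn' H hH hm => by
      have hδn := hδ n
      rcases lt_or_ge (δ n) (1 / (4 * 2 ^ k)) with hlt | hge
      · refine (hmid (U n) (δ n) hn.le hlt (hU n) H hH hm).trans ?_
        gcongr
        linarith
      · refine (card_meet_le_of_large hτ hge (hU n) H (hH.trans hF) hm).trans ?_
        calc (dyadicPrimes k).card * (18 * 2 ^ k * δ n) ^ m * (cellIndex τ T k).card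
            = 36 ^ m * (δ n / r) ^ m *
              ((dyadicPrimes k).card * (2 ^ k * r / 2) ^ m * (cellIndex τ T k).card) := by
              have : (18 * 2 ^ k * δ n) ^ m = 36 ^ m * (δ n / r) ^ m * (2 ^ k * r / 2) ^ m := by
                rw [← mul_pow, ← mul_pow]
                congr 1
                field_simp
                norm_num
              rw [this]; ring
          _ ≤ 36 ^ m * (δ n / r) ^ s * (2 * F.card) := by
              have h1 : (δ n / r) ^ m ≤ (δ n / r) ^ s := by
                rw [← Real.rpow_natCast]
                exact Real.rpow_le_rpow_of_exponent_ge (by positivity)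
                  ((div_le_one hr).2 hn') hsm.le
              gcongr
          _ = _ := by ring)
  have hxc := mem_cellsIn.1 (hF hx)
  have hsub := closedCell_subset hτ (hF hx)
  refine ⟨cellCorner τ T k x.1.1 x.1.2 x.2, r', N', x.1.1,
    ⟨hr'0, fun i => ?_, fun i => ?_, hxlight, hF2 x hx⟩, hsub, ?_, hN', ?_, fun y hy => ?_, hF1 x hx⟩
  · exact (hb i).trans (le_of_closedCube_subset hr'0.le hsub i).1
  · exact (le_of_closedCube_subset hr'0.le hsub i).2.trans (hb1 i)
  · refine hr'1.le.trans ?_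
    rw [div_le_iff₀ (by positivity)]
    linarith
  · exact_mod_cast hkN.trans_le (le_of_mem_dyadicPrimes hxc.1.1)
  · exact ⟨x.1.2, fun i => abs_sub_lt_of_mem_cell hτ hxc.1.1 hxc.2 hy i⟩

lemma exists_admissible {m : ℕ} {τ : Fin m → ℝ} {c s ε : ℝ} {U : ℕ → Set (Fin m → ℝ)} {δ : ℕ → ℝ}
    (hτ : ∀ i, 0 < τ i) (hσ : 1 < ∑ i, τ i) (hc : 0 < c) (hc1 : 2 * c ≤ 1)
    (hsum : ∑' n, ENNReal.ofReal (δ n ^ s) ≤ ENNReal.ofReal ε) :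
    ∃ N, Admissible τ c s ε U δ (fun _ => 0) 1 N := by
  have h8 : (0 : ℝ) < (1 / 4) ^ m / 8 / 8 ^ m := by positivity
  obtain ⟨N, hN⟩ := ((tendsto_zetaTail hσ).eventually_le_const (ENNReal.ofReal_pos.2 h8)).exists
  refine ⟨N, one_pos, fun _ => le_rfl, fun _ => by simp, ?_, ?_⟩
  · rw [Real.one_rpow, mul_one]
    refine le_trans (ENNReal.tsum_le_tsum fun n => ?_) hsum
    exact Set.indicator_le_self _ _ _
  · have h := volume_unitCube_inter_nearTail_le (by positivity) hc1 hτ N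
    have e : icoCube (fun _ : Fin m => (0 : ℝ)) 1 = univ.pi fun _ => Ico (0 : ℝ) 1 := by
      simp [icoCube]
    rw [e]
    refine h.trans ((mul_le_mul_right hN _).trans ?_)
    rw [← ENNReal.ofReal_mul (by positivity)]
    refine ENNReal.ofReal_le_ofReal (le_of_eq ?_)
    rw [one_pow, mul_one, mul_div_cancel₀ _ (by positivity)]

lemma exists_mem_badSet_notMem {m : ℕ} {τ : Fin m → ℝ} {T c s s₁ ε : ℝ}
    {U : ℕ → Set (Fin m → ℝ)} {δ : ℕ → ℝ}
    (hτ : ∀ i, 0 < τ i) (hT : ∀ i, τ i ≤ T) (hT0 : 0 < T) (hσ : 1 < ∑ i, τ i) (hc : 0 < c)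
    (hcT : 2 * c ≤ 2 ^ (-(2 + T))) (hs : 0 < s) (hss₁ : s < s₁) (hsm : s < m)
    (hs₁ : ∀ t : ℝ, 0 ≤ t → s₁ * (1 + t) ≤ m + 1 + ∑ i, max 0 (t - τ i))
    (hε : ε = 1 / (2 * (2 * 36 ^ m))) (hδ : ∀ n, 0 < δ n)
    (hU : ∀ n, ∀ y ∈ U n, ∀ z ∈ U n, ∀ i, y i - z i ≤ δ n)
    (hsum : ∑' n, ENNReal.ofReal (δ n ^ s) ≤ ENNReal.ofReal ε) :
    ∃ x ∈ badSet m (psiTau m τ), ∀ n, x ∉ U n := by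
  have hc1 : 2 * c ≤ 1 := hcT.trans (Real.rpow_le_one_of_one_le_of_nonpos (by norm_num) (by linarith))
  obtain ⟨N₀, hN₀⟩ := exists_admissible (U := U) hτ hσ hc hc1 hsum
  let S := {p : (Fin m → ℝ) × ℝ × ℕ // Admissible τ c s ε U δ p.1 p.2.1 p.2.2}
  have hstep : ∀ p : S, ∃ p' : S, ∃ q : ℕ, closedCube p'.1.1 p'.1.2.1 ⊆ closedCube p.1.1 p.1.2.1 ∧
      p'.1.2.1 ≤ p.1.2.1 / 2 ∧ p.1.2.2 < p'.1.2.2 ∧ p.1.2.2 < q ∧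
      (∀ x ∈ closedCube p'.1.1 p'.1.2.1,
        ∃ P : Fin m → ℤ, ∀ i, |(q : ℝ) * x i - P i| < (q : ℝ) ^ (-τ i)) ∧
      ∀ n, p.1.2.2 < n → n ≤ p'.1.2.2 → Disjoint (closedCube p'.1.1 p'.1.2.1) (nearRat c τ n) := by
    rintro ⟨⟨b, r, N⟩, hp⟩
    obtain ⟨b', r', N', q, h, h'⟩ :=
      hp.exists_next hτ hT hT0 hσ hc hcT hs hss₁ hsm hs₁ hε hδ hU
    exact ⟨⟨⟨b', r', N'⟩, h⟩, q, h'⟩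
  choose next q hsub hhalf hN hq happrox hdisj using hstep
  let f : ℕ → S := fun n => next^[n] ⟨⟨fun _ => 0, 1, N₀⟩, hN₀⟩
  have hf : ∀ n, f (n + 1) = next (f n) := fun n => Function.iterate_succ_apply' _ _ _
  set Q : ℕ → Set (Fin m → ℝ) := fun n => closedCube (f n).1.1 (f n).1.2.1 with hQ
  have hr0 : ∀ n, 0 < (f n).1.2.1 := fun n => (f n).2.pos
  obtain ⟨x, hx⟩ : (⋂ n, Q n).Nonempty := by
    refine IsCompact.nonempty_iInter_of_sequence_nonempty_isCompact_isClosed Q (fun n => ?_)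
      (fun n => ⟨(f n).1.1, fun i _ => ⟨le_rfl, by linarith [hr0 n]⟩⟩)
      (isCompact_univ_pi fun _ => isCompact_Icc) fun n => isClosed_set_pi fun _ _ => isClosed_Icc
    simp only [hQ, hf]
    exact hsub _
  rw [mem_iInter] at hx
  have hNk : ∀ n, n ≤ (f n).1.2.2 := by
    intro n
    induction n with
    | zero => exact Nat.zero_le _
    | succ n ih => rw [hf]; have := hN (f n); omega
  have hrk : ∀ n, (f n).1.2.1 ≤ (1 / 2) ^ n := by
    intro n
    induction n with
    | zero => simp [f]
    | succ n ih => rw [hf, pow_succ]; linarith [hhalf (f n)]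
  have hfar : ∀ k n, N₀ < n → n ≤ (f k).1.2.2 → x ∉ nearRat c τ n := by
    intro k
    induction k with
    | zero => intro n h1 h2; exact absurd h2 (not_le.2 h1)
    | succ k ih =>
      intro n h1 h2
      rcases le_or_gt n (f k).1.2.2 with h3 | h3
      · exact ih n h1 h3
      · have h4 := hx (k + 1)
        simp only [hQ, hf] at h2 h4
        exact Set.disjoint_left.1 (hdisj (f k) n h3 h2) h4
  have hx01 : ∀ i, x i ∈ Icc (0 : ℝ) 1 := fun i => by
    have h1 := hx 0 i (mem_univ i)
    exact ⟨((f 0).2.nonneg i).trans h1.1, h1.2.trans ((f 0).2.le_one i)⟩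
  refine ⟨x, ⟨⟨hx01, ?_⟩, ?_⟩, fun n hn => ?_⟩
  · refine Set.infinite_of_forall_exists_gt fun a => ⟨q (f a), ⟨?_, ?_⟩, ?_⟩
    · exact (Nat.zero_le _).trans_lt (hq (f a))
    · have h1 := hx (a + 1)
      simp only [hQ, hf] at h1
      exact happrox (f a) x h1
    · exact (hNk a).trans_lt (hq (f a))
  · intro hmem
    have h1 := Set.mem_iInter₂.1 hmem c ⟨hc, by linarith⟩
    refine h1.2 ((Set.finite_Iic N₀).subset fun n hn => ?_)
    by_contra hlt
    refine hfar n n (not_le.1 hlt) (hNk n) fun i _ => ?_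
    obtain ⟨_, p, hp⟩ := hn
    exact ⟨p i, hp i⟩
  · have hδn := hδ n
    have h1 : ∀ k : ℕ, δ n ≤ (1 / 2) ^ k := by
      intro k
      refine le_trans ?_ (hrk k)
      have h2 := (ENNReal.le_tsum n).trans (f k).2.light
      have hrk0 := hr0 k
      have hε0 : 0 < ε := by rw [hε]; positivity
      rw [Set.indicator_of_mem (show n ∈ {n | (closedCube (f k).1.1 (f k).1.2.1 ∩ U n).Nonempty} from
        ⟨x, hx k, hn⟩), ENNReal.ofReal_le_ofReal_iff (by positivity)] at h2
      have hε1 : ε ≤ 1 := by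
        have : (1 : ℝ) ≤ 36 ^ m := one_le_pow₀ (by norm_num)
        rw [hε, div_le_one (by positivity)]
        linarith
      have h3 : 0 < (f k).1.2.1 ^ s := by positivity
      exact (Real.rpow_le_rpow_iff hδn.le hrk0.le hs).1 (by nlinarith)
    obtain ⟨k, hk⟩ := exists_pow_lt_of_lt_one hδn (by norm_num : (1 / 2 : ℝ) < 1)
    exact absurd (h1 k) (not_le.2 hk)

lemma hausdorffMeasure_badSet_ne_zero {m : ℕ} {τ : Fin m → ℝ} {s s₁ : ℝ}
    (hτ : ∀ i, 0 < τ i) (hσ : 1 < ∑ i, τ i) (hs : 0 < s) (hss₁ : s < s₁) (hsm : s < m)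
    (hs₁ : ∀ t : ℝ, 0 ≤ t → s₁ * (1 + t) ≤ m + 1 + ∑ i, max 0 (t - τ i)) :
    Measure.hausdorffMeasure s (badSet m (psiTau m τ)) ≠ 0 := by
  set T : ℝ := ∑ i, τ i with hTdef
  have hT : ∀ i, τ i ≤ T := fun i =>
    Finset.single_le_sum (fun j _ => (hτ j).le) (Finset.mem_univ i)
  set ε : ℝ := 1 / (2 * (2 * 36 ^ m)) with hε
  have hε0 : 0 < ε := by positivity
  intro h0
  rw [Measure.hausdorffMeasure_apply] at h0
  have h1 := (le_iSup₂ (f := fun (r : ENNReal) (_ : 0 < r) =>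
    ⨅ (t : ℕ → Set (Fin m → ℝ)) (_ : badSet m (psiTau m τ) ⊆ ⋃ n, t n)
      (_ : ∀ n, Metric.ediam (t n) ≤ r),
      ∑' n, ⨆ _ : (t n).Nonempty, Metric.ediam (t n) ^ s) 1 one_pos).trans h0.le
  have h2 : ∃ t : ℕ → Set (Fin m → ℝ), badSet m (psiTau m τ) ⊆ ⋃ n, t n ∧
      (∀ n, Metric.ediam (t n) ≤ 1) ∧
      ∑' n, ⨆ _ : (t n).Nonempty, Metric.ediam (t n) ^ s < ENNReal.ofReal (ε / 2) := by
    have h3 := h1.trans_lt (ENNReal.ofReal_pos.2 (half_pos hε0))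
    simp only [iInf_lt_iff] at h3
    obtain ⟨t, ht1, ht2, ht3⟩ := h3
    exact ⟨t, ht1, ht2, ht3⟩
  obtain ⟨t, ht1, ht2, ht3⟩ := h2
  have hne : ∀ n, Metric.ediam (t n) ≠ ⊤ := fun n => ((ht2 n).trans_lt ENNReal.one_lt_top).ne
  set w : ℕ → ℝ := fun n => ε / 2 / 2 / 2 ^ n with hw
  have hw0 : ∀ n, 0 < w n := fun n => by simp only [hw]; positivity
  set d : ℕ → ℝ := fun n => Metric.diam (t n) with hd
  have hd0 : ∀ n, 0 ≤ d n := fun n => Metric.diam_nonneg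
  set δ : ℕ → ℝ := fun n => (d n ^ s + w n) ^ (1 / s) with hδ
  have hpos : ∀ n, 0 < d n ^ s + w n := fun n =>
    add_pos_of_nonneg_of_pos (Real.rpow_nonneg (hd0 n) _) (hw0 n)
  have hδs : ∀ n, δ n ^ s = d n ^ s + w n := fun n => by
    simp only [hδ]
    rw [← Real.rpow_mul (hpos n).le, one_div_mul_cancel hs.ne', Real.rpow_one]
  have hδ0 : ∀ n, 0 < δ n := fun n => Real.rpow_pos_of_pos (hpos n) _
  have hdδ : ∀ n, d n ≤ δ n := fun n =>
    (Real.rpow_le_rpow_iff (hd0 n) (hδ0 n).le hs).1 (by rw [hδs]; linarith [hw0 n])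
  have hsum : ∑' n, ENNReal.ofReal (δ n ^ s) ≤ ENNReal.ofReal ε := by
    have e1 : ∀ n, ENNReal.ofReal (δ n ^ s) ≤
        (⨆ _ : (t n).Nonempty, Metric.ediam (t n) ^ s) + ENNReal.ofReal (w n) := by
      intro n
      rw [hδs, ENNReal.ofReal_add (Real.rpow_nonneg (hd0 n) _) (hw0 n).le]
      gcongr
      rw [← ENNReal.ofReal_rpow_of_nonneg (hd0 n) hs.le]
      rcases (t n).eq_empty_or_nonempty with h | h
      · simp [hd, h, hs]
      · refine le_trans ?_ (le_iSup (fun _ : (t n).Nonempty => Metric.ediam (t n) ^ s) h)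
        simp only [hd, Metric.diam]
        rw [ENNReal.ofReal_toReal (hne n)]
    refine (ENNReal.tsum_le_tsum e1).trans ?_
    rw [ENNReal.tsum_add, ← add_halves ε, ENNReal.ofReal_add (half_pos hε0).le (half_pos hε0).le]
    refine add_le_add ht3.le ?_
    rw [← ENNReal.ofReal_tsum_of_nonneg (fun n => (hw0 n).le) (summable_geometric_two' (ε / 2)),
      tsum_geometric_two' (ε / 2)]
  obtain ⟨x, hxB, hx⟩ := exists_mem_badSet_notMem (T := T) (c := 2 ^ (-(2 + T)) / 2) (U := t) (δ := δ)
    hτ hT (by linarith) hσ (by positivity) (by linarith) hs hss₁ hsm hs₁ hε hδ0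
    (fun n y hy z hz i => by
      refine le_trans ?_ (hdδ n)
      have h3 := Metric.dist_le_diam_of_mem' (hne n) hy hz
      exact (le_abs_self _).trans ((dist_le_pi_dist y z i).trans h3)) hsum
  obtain ⟨n, hn⟩ := mem_iUnion.1 (ht1 hxB)
  exact hx n hn

/-- The number of cubes of side `q ^ (-(1 + t))` needed to cover a side of a box of
`τ`-approximable points with denominator `q`. -/
def coverCount {m : ℕ} (τ : Fin m → ℝ) (t : ℝ) (q : ℕ) (i : Fin m) : ℕ :=
  ⌈2 * (q : ℝ) ^ (t - τ i)⌉₊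

/-- A cube of side `q ^ (-(1 + t))` in the covering of the box around `p / q`. -/
def coverCube {m : ℕ} (τ : Fin m → ℝ) (t : ℝ) (q : ℕ) (p j : Fin m → ℕ) : Set (Fin m → ℝ) :=
  closedCube (fun i => (p i - (q : ℝ) ^ (-τ i)) / q + j i * (q : ℝ) ^ (-(1 + t)))
    ((q : ℝ) ^ (-(1 + t)))

lemma ediam_closedCube_le {m : ℕ} (b : Fin m → ℝ) (r : ℝ) :
    Metric.ediam (closedCube b r) ≤ ENNReal.ofReal r := by
  refine Metric.ediam_le fun x hx y hy => edist_pi_le_iff.2 fun i => ?_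
  have h1 := hx i (mem_univ i)
  have h2 := hy i (mem_univ i)
  rw [edist_dist, Real.dist_eq]
  refine ENNReal.ofReal_le_ofReal (abs_le.2 ?_)
  simp only [mem_Icc] at h1 h2
  constructor <;> linarith [h1.1, h1.2, h2.1, h2.2]

lemma coverCount_le {m q : ℕ} (hq : 0 < q) (τ : Fin m → ℝ) (t : ℝ) (i : Fin m) :
    (coverCount τ t q i : ℝ) ≤ 3 * (q : ℝ) ^ max 0 (t - τ i) := by
  have hq1 : (1 : ℝ) ≤ q := by exact_mod_cast hq
  have h1 : (q : ℝ) ^ (t - τ i) ≤ (q : ℝ) ^ max 0 (t - τ i) :=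
    Real.rpow_le_rpow_of_exponent_le hq1 (le_max_right _ _)
  have h2 : (1 : ℝ) ≤ (q : ℝ) ^ max 0 (t - τ i) := Real.one_le_rpow hq1 (le_max_left _ _)
  have h3 := Nat.ceil_lt_add_one (a := 2 * (q : ℝ) ^ (t - τ i)) (by positivity)
  unfold coverCount
  linarith

lemma exists_mem_coverCube {m q : ℕ} (hq : 0 < q) {τ : Fin m → ℝ} (hτ : ∀ i, 0 < τ i) (t : ℝ)
    {x : Fin m → ℝ} (hx : ∀ i, x i ∈ Icc (0 : ℝ) 1) {p : Fin m → ℤ}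
    (hp : ∀ i, |(q : ℝ) * x i - p i| < (q : ℝ) ^ (-τ i)) :
    ∃ p' j : Fin m → ℕ, (∀ i, p' i < q + 1) ∧ (∀ i, j i < coverCount τ t q i) ∧
      x ∈ coverCube τ t q p' j := by
  have hq0 : (0 : ℝ) < q := by exact_mod_cast hq
  have hq1 : (1 : ℝ) ≤ q := by exact_mod_cast hq
  have h : ∀ i, ∃ a j : ℕ, a < q + 1 ∧ j < coverCount τ t q i ∧
      x i ∈ Icc ((a - (q : ℝ) ^ (-τ i)) / q + j * (q : ℝ) ^ (-(1 + t)))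
        ((a - (q : ℝ) ^ (-τ i)) / q + j * (q : ℝ) ^ (-(1 + t)) + (q : ℝ) ^ (-(1 + t))) := by
    intro i
    have h1 : (q : ℝ) ^ (-τ i) ≤ 1 :=
      Real.rpow_le_one_of_one_le_of_nonpos hq1 (by linarith [hτ i])
    obtain ⟨h2, h3⟩ := abs_lt.1 (hp i)
    obtain ⟨h4, h5⟩ := hx i
    have h6 : (q : ℝ) * x i ≤ q := by nlinarith
    have h7 : 0 ≤ (q : ℝ) * x i := by positivity
    have h8 : (-1 : ℤ) < p i := by
      have : (-1 : ℝ) < p i := by linarith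
      exact_mod_cast this
    have h9 : p i < q + 1 := by
      have : (p i : ℝ) < q + 1 := by linarith
      exact_mod_cast this
    obtain ⟨a, ha⟩ := Int.eq_ofNat_of_zero_le (show 0 ≤ p i by omega)
    rw [ha, Int.cast_natCast] at h2 h3
    have hr : (0 : ℝ) < (q : ℝ) ^ (-(1 + t)) := by positivity
    set u := x i - (a - (q : ℝ) ^ (-τ i)) / q with hu
    have hqu : q * u = q * x i - a + (q : ℝ) ^ (-τ i) := by
      rw [hu, mul_sub, mul_div_cancel₀ _ hq0.ne']; ring
    have hu0 : 0 ≤ u := by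
      refine le_of_mul_le_mul_left ?_ hq0
      rw [mul_zero, hqu]; linarith
    have hu1 : u / (q : ℝ) ^ (-(1 + t)) < 2 * (q : ℝ) ^ (t - τ i) := by
      rw [div_lt_iff₀ hr, mul_assoc, ← Real.rpow_add hq0]
      have e : (q : ℝ) * (2 * (q : ℝ) ^ (t - τ i + -(1 + t))) = 2 * (q : ℝ) ^ (-τ i) := by
        rw [mul_left_comm]
        nth_rewrite 1 [← Real.rpow_one (q : ℝ)]
        rw [← Real.rpow_add hq0]; congr 2; ring
      refine lt_of_mul_lt_mul_left ?_ hq0.le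
      rw [e, hqu]; linarith
    have hj0 := Nat.floor_le (div_nonneg hu0 hr.le)
    have hj1 := (Nat.lt_floor_add_one (u / (q : ℝ) ^ (-(1 + t)))).le
    rw [le_div_iff₀ hr] at hj0
    rw [div_le_iff₀ hr] at hj1
    refine ⟨a, ⌊u / (q : ℝ) ^ (-(1 + t))⌋₊, by omega, ?_, ?_, ?_⟩
    · exact (Nat.floor_lt (div_nonneg hu0 hr.le)).2 (hu1.trans_le (Nat.le_ceil _))
    · linarith
    · linarith
  choose p' j h1 h2 h3 using h
  exact ⟨p', j, h1, h2, fun i _ => h3 i⟩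

lemma card_cover_mul_le {m q : ℕ} (hq : 0 < q) (τ : Fin m → ℝ) (t s : ℝ) :
    ((q + 1 : ℕ) : ℝ) ^ m * (∏ i, (coverCount τ t q i : ℝ)) * (q : ℝ) ^ (-(1 + t) * s) ≤
      6 ^ m * (q : ℝ) ^ (m + ∑ i, max 0 (t - τ i) - s * (1 + t)) := by
  have hq0 : (0 : ℝ) < q := by exact_mod_cast hq
  have hq1 : (1 : ℝ) ≤ q := by exact_mod_cast hq
  have h1 : ((q + 1 : ℕ) : ℝ) ^ m ≤ (2 * q) ^ m := by
    push_cast; gcongr; linarith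
  have h2 : ∏ i, (coverCount τ t q i : ℝ) ≤ 3 ^ m * (q : ℝ) ^ (∑ i, max 0 (t - τ i)) := by
    refine (Finset.prod_le_prod (fun _ _ => by positivity)
      fun i _ => coverCount_le hq τ t i).trans_eq ?_
    rw [Finset.prod_mul_distrib, Finset.prod_const, Real.rpow_sum_of_pos hq0]
    simp
  calc _ ≤ (2 * (q : ℝ)) ^ m * (3 ^ m * (q : ℝ) ^ (∑ i, max 0 (t - τ i))) *
        (q : ℝ) ^ (-(1 + t) * s) := by gcongr
    _ = (2 ^ m * 3 ^ m) * ((q : ℝ) ^ (m : ℝ) * (q : ℝ) ^ (∑ i, max 0 (t - τ i)) *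
        (q : ℝ) ^ (-(1 + t) * s)) := by rw [mul_pow, Real.rpow_natCast]; ring
    _ = _ := by
        rw [← mul_pow, ← Real.rpow_add hq0, ← Real.rpow_add hq0]
        norm_num only
        congr 2; ring

lemma hausdorffMeasure_approxSet_ne_top {m : ℕ} {τ : Fin m → ℝ} {s t : ℝ} (hτ : ∀ i, 0 < τ i)
    (hs : 0 ≤ s) (ht : 0 ≤ t) (hst : m + 1 + ∑ i, max 0 (t - τ i) < s * (1 + t)) :
    Measure.hausdorffMeasure s (approxSet m (psiTau m τ)) ≠ ⊤ := by
  set e : ℝ := m + ∑ i, max 0 (t - τ i) - s * (1 + t) with he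
  have hsum : Summable fun q : ℕ => (6 : ℝ) ^ m * (q : ℝ) ^ e :=
    (Real.summable_nat_rpow.2 (by linarith)).mul_left _
  let ι : ℕ → Type := fun n => (k : ℕ) × ((Fin m → Fin (n + 1 + k + 1)) ×
    (∀ i, Fin (coverCount τ t (n + 1 + k) i)))
  let C : ∀ n, ι n → Set (Fin m → ℝ) := fun n x =>
    coverCube τ t (n + 1 + x.1) (fun i => x.2.1 i) (fun i => x.2.2 i)
  have hlim : Filter.Tendsto (fun n : ℕ => ENNReal.ofReal (((n + 1 : ℕ) : ℝ) ^ (-(1 + t))))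
      Filter.atTop (nhds 0) := by
    rw [← ENNReal.ofReal_zero]
    refine ENNReal.tendsto_ofReal ?_
    exact (tendsto_rpow_neg_atTop (by linarith)).comp
      (tendsto_natCast_atTop_atTop.comp (Filter.tendsto_add_atTop_nat 1))
  have hdiam : ∀ n (x : ι n), Metric.ediam (C n x) ≤
      ENNReal.ofReal (((n + 1 + x.1 : ℕ) : ℝ) ^ (-(1 + t))) :=
    fun n x => ediam_closedCube_le _ _
  have hcover : ∀ n, approxSet m (psiTau m τ) ⊆ ⋃ x, C n x := by
    rintro n x ⟨hx, hinf⟩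
    obtain ⟨q, ⟨hq, p, hp⟩, hnq⟩ := hinf.exists_gt n
    obtain ⟨k, rfl⟩ := Nat.exists_eq_add_of_le (Nat.succ_le_of_lt hnq)
    obtain ⟨p', j, h1, h2, h3⟩ := exists_mem_coverCube hq hτ t hx hp
    exact mem_iUnion.2 ⟨⟨k, fun i => ⟨p' i, h1 i⟩, fun i => ⟨j i, h2 i⟩⟩, h3⟩
  have hbound : ∀ n, ∑' x, Metric.ediam (C n x) ^ s ≤
      ENNReal.ofReal (∑' q : ℕ, (6 : ℝ) ^ m * (q : ℝ) ^ e) := by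
    intro n
    rw [ENNReal.ofReal_tsum_of_nonneg (fun _ => by positivity) hsum, ENNReal.tsum_sigma']
    refine le_trans (ENNReal.tsum_le_tsum fun k => ?_)
      (ENNReal.tsum_comp_le_tsum_of_injective (add_right_injective (n + 1)) _)
    set q := n + 1 + k with hq
    have hq0 : 0 < q := by omega
    have hr : (0 : ℝ) ≤ (q : ℝ) ^ (-(1 + t)) := by positivity
    refine (ENNReal.tsum_le_tsum fun x =>
      ENNReal.rpow_le_rpow (hdiam n ⟨k, x⟩) hs).trans ?_
    simp only [← hq]
    rw [tsum_fintype, Finset.sum_const, Finset.card_univ, Fintype.card_prod, Fintype.card_pi,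
      Fintype.card_pi, nsmul_eq_mul, ENNReal.ofReal_rpow_of_nonneg hr hs,
      ← Real.rpow_mul (Nat.cast_nonneg _), ← ENNReal.ofReal_natCast,
      ← ENNReal.ofReal_mul (Nat.cast_nonneg _)]
    refine ENNReal.ofReal_le_ofReal (le_trans (le_of_eq ?_) (card_cover_mul_le hq0 τ t s))
    simp [hq]
  refine ne_top_of_le_ne_top (b := ENNReal.ofReal (∑' q : ℕ, (6 : ℝ) ^ m * (q : ℝ) ^ e))
    ENNReal.ofReal_ne_top
    ((Measure.hausdorffMeasure_le_liminf_tsum s _ _ hlim C (.of_forall fun n x => ?_)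
      (.of_forall hcover)).trans (Filter.liminf_le_of_le (by isBoundedDefault) ?_))
  · refine (hdiam n x).trans (ENNReal.ofReal_le_ofReal ?_)
    refine Real.rpow_le_rpow_of_nonpos (by positivity) ?_ (by linarith)
    exact_mod_cast Nat.le_add_right _ _
  · intro b hb
    obtain ⟨n, hn⟩ := hb.exists
    exact hn.trans (hbound n)

/-- for `τ ∈ ℝ_{>0}^m` with `τ1 + ⋯ + τm > 1`,
`dim_H B_m(Ψ_τ) = dim_H A_m(Ψ_τ)`. -/
theorem stmt17 (m : ℕ) (hm : 1 ≤ m) (τ : Fin m → ℝ) (hτ : ∀ i, 0 < τ i)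
    (hσ : 1 < ∑ i, τ i) :
    dimH (badSet m (psiTau m τ)) = dimH (approxSet m (psiTau m τ)) := by
  refine le_antisymm (dimH_mono sdiff_subset) (ENNReal.le_of_forall_nnreal_lt fun s hs => ?_)
  obtain ⟨s₁, hss₁, hs₁⟩ := ENNReal.lt_iff_exists_nnreal_btwn.1 hs
  rcases eq_or_lt_of_le (zero_le (a := s)) with rfl | hs0
  · simp
  have hss₁' : (s : ℝ) < s₁ := by exact_mod_cast hss₁
  have hbd : ∀ t : ℝ, 0 ≤ t → (s₁ : ℝ) * (1 + t) ≤ m + 1 + ∑ i, max 0 (t - τ i) := by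
    intro t ht
    by_contra! h
    exact (dimH_le_of_hausdorffMeasure_ne_top
      (hausdorffMeasure_approxSet_ne_top hτ s₁.2 ht h)).not_gt hs₁
  refine le_dimH_of_hausdorffMeasure_ne_zero
    (hausdorffMeasure_badSet_ne_zero hτ hσ (by exact_mod_cast hs0) hss₁' ?_ hbd)
  have hT : ∀ i, τ i ≤ ∑ i, τ i := fun i =>
    Finset.single_le_sum (fun j _ => (hτ j).le) (Finset.mem_univ i)
  have h := hbd (∑ i, τ i) (by linarith)
  rw [Finset.sum_congr rfl fun i _ => max_eq_right (sub_nonneg.2 (hT i)),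
    Finset.sum_sub_distrib, Finset.sum_const, Finset.card_univ, Fintype.card_fin,
    nsmul_eq_mul] at h
  refine hss₁'.trans (lt_of_mul_lt_mul_right (a := 1 + ∑ i, τ i) ?_ (by linarith))
  linarith
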